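/- Bourgain genericity coincides with Bossard genericity: an isomorphic-invariant class C of non-universal separable Banach spaces is Bourgain generic if and only if it is Bossard generic. -/

import Mathlib

open Filter Topology MeasureTheory

noncomputable section

/-! ### The Cantor set and the space `C(2^ℕ)` -/

/-- The Cantor set `2^ℕ`. -/
abbrev CantorSet : Type := ℕ → Bool

/-- The Banach space `C(2^ℕ)` of continuous real-valued functions on the Cantor set. -/
abbrev CantorC : Type := C(CantorSet, ℝ)

/-! ### The standard Borel space `SB` of separable Banach spaces -/

/-- `SB`: the set of closed linear subspaces of `C(2^ℕ)`. -/
def SB : Type := {Y : Submodule ℝ CantorC // IsClosed (Y : Set CantorC)}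

/-- The Effros-Borel σ-algebra on `SB`, generated by the sets
`{Y : Y ∩ U ≠ ∅}` for `U` open in `C(2^ℕ)`. -/
instance : MeasurableSpace SB :=
  MeasurableSpace.generateFrom
    {A : Set SB | ∃ U : Set CantorC, IsOpen U ∧ A = {Y : SB | ((Y.1 : Set CantorC) ∩ U).Nonempty}}

/-- A subset of a standard Borel space is analytic if it is the image of a Borel map
from the Baire space `ℕ^ℕ`. -/
def IsAnalyticIn {α : Type*} [MeasurableSpace α] (A : Set α) : Prop :=
  ∃ f : (ℕ → ℕ) → α, Measurable f ∧ A = Set.range f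

/-! ### Embeddings, isomorphisms, universality -/

/-- `X` embeds isomorphically into `Y`: there is a bounded linear map which is
bounded below, i.e. an isomorphism onto its range. -/
def Embeds (X Y : Type*) [SeminormedAddCommGroup X] [NormedSpace ℝ X]
    [SeminormedAddCommGroup Y] [NormedSpace ℝ Y] : Prop :=
  ∃ (T : X →L[ℝ] Y) (c : ℝ), 0 < c ∧ ∀ x : X, c * ‖x‖ ≤ ‖T x‖

/-- `X` embeds isometrically into `Y` (i.e. `Y` contains an isometric copy of `X`). -/
def EmbedsIsometrically (X Y : Type*) [SeminormedAddCommGroup X] [NormedSpace ℝ X]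
    [SeminormedAddCommGroup Y] [NormedSpace ℝ Y] : Prop :=
  Nonempty (X →ₗᵢ[ℝ] Y)

/-- `X` and `Y` are isomorphic Banach spaces (linearly homeomorphic). -/
def IsomorphicTo (X Y : Type*) [SeminormedAddCommGroup X] [NormedSpace ℝ X]
    [SeminormedAddCommGroup Y] [NormedSpace ℝ Y] : Prop :=
  Nonempty (X ≃L[ℝ] Y)

/-- The class `NU ⊆ SB` of non-universal spaces: those `X ∈ SB` which do not contain
an isomorphic copy of `C(2^ℕ)` (equivalently, are not universal for all separable
Banach spaces). -/
def NU : Set SB := {Y : SB | ¬ Embeds CantorC Y.1}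

/-- The class `NC_X ⊆ SB` of all `Y ∈ SB` containing no isomorphic copy of `X`. -/
def NCin (X : Type*) [SeminormedAddCommGroup X] [NormedSpace ℝ X] : Set SB :=
  {Y : SB | ¬ Embeds X Y.1}

/-! ### Schauder bases -/

/-- `x` is a Schauder basis of `E`: every vector has a unique representation as a
norm convergent series `Σ aₙ • xₙ`. -/
def IsSchauderBasis {E : Type*} [SeminormedAddCommGroup E] [NormedSpace ℝ E]
    (x : ℕ → E) : Prop :=
  ∀ y : E, ∃! a : ℕ → ℝ,
    Tendsto (fun m => ∑ n ∈ Finset.range m, a n • x n) atTop (𝓝 y)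

/-- `E` has a Schauder basis. -/
def HasSchauderBasis (E : Type*) [SeminormedAddCommGroup E] [NormedSpace ℝ E] : Prop :=
  ∃ x : ℕ → E, IsSchauderBasis x

/-- `x` is a monotone basis sequence: initial-segment projections have norm at most 1. -/
def IsMonotoneSeq {E : Type*} [SeminormedAddCommGroup E] [NormedSpace ℝ E]
    (x : ℕ → E) : Prop :=
  ∀ (a : ℕ → ℝ) (k m : ℕ), k ≤ m →
    ‖∑ n ∈ Finset.range k, a n • x n‖ ≤ ‖∑ n ∈ Finset.range m, a n • x n‖

/-- `x` is a bi-monotone sequence: interval projections have norm at most 1. -/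
def IsBimonotoneSeq {E : Type*} [SeminormedAddCommGroup E] [NormedSpace ℝ E]
    (x : ℕ → E) : Prop :=
  ∀ (a : ℕ → ℝ) (j k m : ℕ), j ≤ k → k ≤ m →
    ‖∑ n ∈ Finset.Ico j k, a n • x n‖ ≤ ‖∑ n ∈ Finset.range m, a n • x n‖

/-- `x` is a Schauder basic sequence: it is a Schauder basis of its closed linear span. -/
def IsSchauderBasicSeq {E : Type*} [NormedAddCommGroup E] [NormedSpace ℝ E]
    (x : ℕ → E) : Prop :=
  ∀ y ∈ (Submodule.span ℝ (Set.range x)).topologicalClosure,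
    ∃! a : ℕ → ℝ,
      Tendsto (fun m => ∑ n ∈ Finset.range m, a n • x n) atTop (𝓝 y)

/-! ### Trees, ordinal ranks and Bourgain's index -/

/-- A tree on `Λ`: a set of finite sequences closed under initial segments. -/
def IsTree {Λ : Type*} (T : Set (List Λ)) : Prop :=
  ∀ s t : List Λ, s <+: t → t ∈ T → s ∈ T

/-- A pruned tree: every node has a proper extension in the tree. -/
def IsPruned {Λ : Type*} (T : Set (List Λ)) : Prop :=
  ∀ t ∈ T, ∃ a : Λ, t ++ [a] ∈ T

/-- `σ` is an infinite branch of `T`. -/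
def IsBranch {Λ : Type*} (T : Set (List Λ)) (σ : ℕ → Λ) : Prop :=
  ∀ n : ℕ, (List.ofFn fun i : Fin n => σ i) ∈ T

/-- `T` is ill-founded: it has an infinite branch. -/
def TreeIllFounded {Λ : Type*} (T : Set (List Λ)) : Prop :=
  ∃ σ : ℕ → Λ, IsBranch T σ

/-- The derivative of a tree: its non-maximal nodes, i.e. nodes having a proper
extension in the tree. -/
def treeDeriv {Λ : Type*} (T : Set (List Λ)) : Set (List Λ) :=
  {l | l ∈ T ∧ ∃ a : Λ, l ++ [a] ∈ T}

/-- The iterated derivatives `T^(ξ)` of a tree, defined by transfinite recursion. -/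
def treeDerivIter {Λ : Type*} (T : Set (List Λ)) (ξ : Ordinal.{0}) : Set (List Λ) :=
  Ordinal.limitRecOn ξ T (fun _ S => treeDeriv S)
    (fun o _ ih => ⋂ (o' : Ordinal.{0}) (h : o' < o), ih o' h)

/-- The ordinal rank `o(T)` of a (well-founded) tree: the least `ξ` with `T^(ξ) = ∅`. -/
def treeRank {Λ : Type*} (T : Set (List Λ)) : Ordinal.{0} :=
  sInf {ξ : Ordinal.{0} | treeDerivIter T ξ = ∅}

/-- The first uncountable ordinal `ω₁`. -/
def omega1 : Ordinal.{0} := (Cardinal.aleph 1).ord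

/-- Bourgain's tree `T(Y, (e_n), δ)`: all finite sequences `(y_0, …, y_k)` in `Y`
which are `δ`-equivalent to `(e_0, …, e_k)`. -/
def bourgainTree {W : Type*} [SeminormedAddCommGroup W] [NormedSpace ℝ W] (e : ℕ → W)
    (δ : ℝ) (Y : Type*) [SeminormedAddCommGroup Y] [NormedSpace ℝ Y] : Set (List Y) :=
  {l : List Y | ∀ a : ℕ → ℝ,
    δ * ‖∑ i ∈ Finset.range l.length, a i • e i‖ ≤
        ‖∑ i ∈ Finset.range l.length, a i • l.getD i 0‖ ∧
    ‖∑ i ∈ Finset.range l.length, a i • l.getD i 0‖ ≤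
        δ⁻¹ * ‖∑ i ∈ Finset.range l.length, a i • e i‖}

open Classical in
/-- Bourgain's ordinal index of `Y` relative to a (normalized Schauder) basis `(e_n)`
of a space `W`: it equals `ω₁` if some tree `T(Y, (e_n), δ)` is ill-founded, and
otherwise `sup_{0 < δ ≤ 1} o(T(Y, (e_n), δ))`.  With `W = C(2^ℕ)` this is `φ_NU`,
and with `W = Z` it is `φ_{NC_Z}`. -/
def bourgainIndex {W : Type*} [SeminormedAddCommGroup W] [NormedSpace ℝ W] (e : ℕ → W)
    (Y : Type*) [SeminormedAddCommGroup Y] [NormedSpace ℝ Y] : Ordinal.{0} :=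
  if ∃ δ ∈ Set.Ioc (0:ℝ) 1, TreeIllFounded (bourgainTree e δ Y) then omega1
  else ⨆ δ : Set.Ioc (0:ℝ) 1, treeRank (bourgainTree e δ.1 Y)

/-! ### The Schur property and the Radon-Nikodym property -/

/-- `X` has the Schur property: weakly convergent sequences are norm convergent. -/
def HasSchurProperty (X : Type*) [SeminormedAddCommGroup X] [NormedSpace ℝ X] : Prop :=
  ∀ (f : ℕ → X) (x : X),
    (∀ φ : X →L[ℝ] ℝ, Tendsto (fun n => φ (f n)) atTop (𝓝 (φ x))) →
    Tendsto f atTop (𝓝 x)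

/-- `X` has the Radon-Nikodym property: on every finite measure space, every
`X`-valued vector measure of bounded variation which is absolutely continuous
with respect to the measure has a Bochner-integrable density. -/
def HasRNP (X : Type*) [NormedAddCommGroup X] [NormedSpace ℝ X] : Prop :=
  ∀ (Ω : Type) [MeasurableSpace Ω] (μ : Measure Ω), IsFiniteMeasure μ →
    ∀ τ : VectorMeasure Ω X,
      (∀ s : Set Ω, MeasurableSet s → μ s = 0 → τ s = 0) →
      (∃ C : ℝ, ∀ P : Finset (Set Ω), (∀ s ∈ P, MeasurableSet s) →
        ((P : Set (Set Ω)).Pairwise fun s t => Disjoint s t) →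
        ∑ s ∈ P, ‖τ s‖ ≤ C) →
      ∃ g : Ω → X, Integrable g μ ∧
        ∀ s : Set Ω, MeasurableSet s → τ s = ∫ x in s, g x ∂μ

/-! ### `𝓛_{∞,λ}`-spaces -/

/-- The Banach-Mazur distance from `G` to `ℓ∞^n` is at most `θ`, witnessed by an
isomorphism `e` with `‖e‖ ⬝ ‖e⁻¹‖ ≤ θ'` for every `θ' > θ`. -/
def BMdistToLinftyLE (G : Type*) [SeminormedAddCommGroup G] [NormedSpace ℝ G]
    (n : ℕ) (θ : ℝ) : Prop :=
  ∀ θ' : ℝ, θ < θ' → ∃ e : G ≃L[ℝ] (Fin n → ℝ),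
    ‖(e : G →L[ℝ] (Fin n → ℝ))‖ * ‖(e.symm : (Fin n → ℝ) →L[ℝ] G)‖ ≤ θ'

/-- `X` is an (infinite-dimensional) `𝓛_{∞,λ}`-space: every finite-dimensional subspace
`F` of `X` is contained in a finite-dimensional subspace `G` with `d(G, ℓ∞^(dim G)) ≤ λ`. -/
def IsLinftyLam (lam : ℝ) (X : Type*) [NormedAddCommGroup X] [NormedSpace ℝ X] : Prop :=
  (¬ FiniteDimensional ℝ X) ∧
  ∀ F : Submodule ℝ X, FiniteDimensional ℝ F →
    ∃ G : Submodule ℝ X, F ≤ G ∧ FiniteDimensional ℝ G ∧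
      BMdistToLinftyLE G (Module.finrank ℝ G) lam

/-- `X` is an `𝓛_{∞,λ+}`-space: it is an `𝓛_{∞,θ}`-space for every `θ > λ`. -/
def IsLinftyPlus (lam : ℝ) (X : Type*) [NormedAddCommGroup X] [NormedSpace ℝ X] : Prop :=
  ∀ θ : ℝ, lam < θ → IsLinftyLam θ X

/-! ### Minimal spaces and `ℓ₁` -/

/-- The space `ℓ₁`. -/
abbrev EllOne : Type := lp (fun _ : ℕ => ℝ) 1

/-- `X` is a minimal Banach space: it is infinite-dimensional and embeds isomorphically
into every infinite-dimensional (closed) subspace of itself. -/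
def IsMinimal (X : Type*) [NormedAddCommGroup X] [NormedSpace ℝ X] : Prop :=
  (¬ FiniteDimensional ℝ X) ∧
  ∀ Z : Submodule ℝ X, IsClosed (Z : Set X) → ¬ FiniteDimensional ℝ Z → Embeds X Z

end


namespace BB
noncomputable section

/-- generic dependent choice -/
theorem dchoice {α : Type*} (Inv : ℕ → α → Prop) (R : ℕ → α → α → Prop)
    (h0 : ∃ a, Inv 0 a) (hs : ∀ n a, Inv n a → ∃ b, Inv (n+1) b ∧ R n a b) :
    ∃ s : ℕ → α, ∀ n, Inv n (s n) ∧ R n (s n) (s (n+1)) := by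
  classical
  obtain ⟨a0, ha0⟩ := h0
  choose! nx hnx using hs
  let s : ℕ → α := fun n => Nat.rec a0 (fun n a => nx n a) n
  have hs : ∀ n, Inv n (s n) := by
    intro n
    induction n with
    | zero => exact ha0
    | succ n ih => exact (hnx n _ ih).1
  exact ⟨s, fun n => ⟨hs n, (hnx n _ (hs n)).2⟩⟩

/-! ### truncation -/
def trunc (n : ℕ) (x : CantorSet) : CantorSet := fun i => if i < n then x i else false

theorem trunc_trunc (n m : ℕ) (x : CantorSet) : trunc n (trunc m x) = trunc (min n m) x := by
  funext i; simp only [trunc, lt_min_iff]; split_ifs <;> simp_all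

theorem continuous_trunc (n : ℕ) : Continuous (trunc n) := by
  unfold trunc
  refine continuous_pi fun i => ?_
  by_cases h : i < n
  · simpa [h] using continuous_apply i
  · simpa [h] using continuous_const

def rr (n : ℕ) : CantorC →ₗ[ℝ] CantorC where
  toFun f := f.comp ⟨trunc n, continuous_trunc n⟩
  map_add' _ _ := rfl
  map_smul' _ _ := rfl

@[simp] theorem rr_apply (n : ℕ) (f : CantorC) (x : CantorSet) : rr n f x = f (trunc n x) := rfl

theorem rr_rr (n m : ℕ) (f : CantorC) : rr n (rr m f) = rr (min n m) f := by
  ext x; simp [trunc_trunc, min_comm]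

theorem norm_rr_le (n : ℕ) (f : CantorC) : ‖rr n f‖ ≤ ‖f‖ :=
  (ContinuousMap.norm_le _ (norm_nonneg _)).2 fun x => f.norm_coe_le_norm _

def SS (n : ℕ) : Submodule ℝ CantorC where
  carrier := {f | rr n f = f}
  add_mem' := by intro a b ha hb; simp only [Set.mem_ofPred_eq, map_add] at *; rw [ha, hb]
  zero_mem' := by simp
  smul_mem' := by intro c a ha; simp only [Set.mem_ofPred_eq, map_smul] at *; rw [ha]

theorem mem_SS {n : ℕ} {f : CantorC} : f ∈ SS n ↔ rr n f = f := Iff.rfl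

theorem rr_mem_SS (n : ℕ) (f : CantorC) : rr n f ∈ SS n := by simp [mem_SS, rr_rr]

theorem SS_mono : Monotone SS := by
  intro n m h f hf
  rw [mem_SS] at *
  rw [← hf, rr_rr, min_eq_right h]

def LL : Submodule ℝ CantorC where
  carrier := {f | ∃ n, f ∈ SS n}
  add_mem' := by
    rintro a b ⟨n, hn⟩ ⟨m, hm⟩
    exact ⟨max n m, add_mem (SS_mono (le_max_left _ _) hn) (SS_mono (le_max_right _ _) hm)⟩
  zero_mem' := ⟨0, zero_mem _⟩
  smul_mem' := by rintro c a ⟨n, hn⟩; exact ⟨n, Submodule.smul_mem _ _ hn⟩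

theorem mem_LL {f : CantorC} : f ∈ LL ↔ ∃ n, f ∈ SS n := Iff.rfl

theorem SS_apply {n : ℕ} {f : CantorC} (hf : f ∈ SS n) {x y : CantorSet}
    (h : ∀ i < n, x i = y i) : f x = f y := by
  rw [mem_SS] at hf
  rw [← hf]
  simp only [rr_apply]
  congr 1
  funext i; simp only [trunc]; split_ifs with hi
  · exact h i hi
  · rfl

def cyl (n : ℕ) (x : CantorSet) : Set CantorSet := {y | ∀ i < n, y i = x i}

theorem isOpen_cyl (n : ℕ) (x : CantorSet) : IsOpen (cyl n x) := by
  have : cyl n x = ⋂ i ∈ Finset.range n, (fun y : CantorSet => y i) ⁻¹' {x i} := by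
    ext y; simp [cyl]
  rw [this]
  exact isOpen_biInter_finset fun i _ => (isOpen_discrete _).preimage (continuous_apply i)

theorem isClosed_cyl (n : ℕ) (x : CantorSet) : IsClosed (cyl n x) := by
  have : cyl n x = ⋂ i ∈ Finset.range n, (fun y : CantorSet => y i) ⁻¹' {x i} := by
    ext y; simp [cyl]
  rw [this]
  exact isClosed_biInter fun i _ => (isClosed_discrete _).preimage (continuous_apply i)

theorem isOpen_level {f : CantorC} (hf : f ∈ LL) (r : ℝ) : IsOpen {x | f x = r} := by
  obtain ⟨n, hn⟩ := hf
  rw [isOpen_iff_forall_mem_open]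
  intro x hx
  refine ⟨cyl n x, fun y hy => ?_, isOpen_cyl n x, fun i _ => rfl⟩
  exact (SS_apply hn hy).trans hx

theorem exists_cyl {U : Set CantorSet} (hU : IsOpen U) {x : CantorSet} (hx : x ∈ U) :
    ∃ n, cyl n x ⊆ U := by
  rw [isOpen_pi_iff] at hU
  obtain ⟨I, u, hu, hsub⟩ := hU x hx
  refine ⟨I.sup id + 1, fun y hy => hsub ?_⟩
  intro i hi
  have : y i = x i := hy i (Nat.lt_succ_of_le (Finset.le_sup (f := id) hi))
  rw [this]; exact (hu i hi).2

open Classical in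
def cylInd (n : ℕ) (x : CantorSet) : CantorC where
  toFun y := if y ∈ cyl n x then 1 else 0
  continuous_toFun := by
    refine Continuous.if ?_ continuous_const continuous_const
    intro a ha
    have : frontier (cyl n x) = ∅ := IsClopen.frontier_eq ⟨isClosed_cyl n x, isOpen_cyl n x⟩
    rw [show {a | a ∈ cyl n x} = cyl n x from rfl, this] at ha
    exact ha.elim

theorem cylInd_mem (n : ℕ) (x : CantorSet) : cylInd n x ∈ SS n := by
  rw [mem_SS]; ext y
  have : trunc n y ∈ cyl n x ↔ y ∈ cyl n x := by
    simp only [cyl, Set.mem_ofPred_eq, trunc]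
    exact forall₂_congr fun i hi => by simp [hi]
  simp only [cylInd, rr_apply, ContinuousMap.coe_mk]
  by_cases h : y ∈ cyl n x
  · rw [if_pos h, if_pos (this.2 h)]
  · rw [if_neg h, if_neg (fun h' => h (this.1 h'))]

theorem split_open {U : Set CantorSet} (hU : IsOpen U) (hne : U.Nonempty) :
    ∃ V W : Set CantorSet, IsOpen V ∧ IsOpen W ∧ V.Nonempty ∧ W.Nonempty ∧ V ⊆ U ∧ W ⊆ U ∧
      Disjoint V W := by
  obtain ⟨x, hx⟩ := hne
  obtain ⟨n, hn⟩ := exists_cyl hU hx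
  let x0 : CantorSet := Function.update x n false
  let x1 : CantorSet := Function.update x n true
  have h0 : ∀ b, cyl (n+1) (Function.update x n b) ⊆ U := by
    intro b y hy
    apply hn
    intro i hi
    rw [hy i (by omega), Function.update_of_ne (by omega)]
  refine ⟨cyl (n+1) x0, cyl (n+1) x1, isOpen_cyl _ _, isOpen_cyl _ _, ⟨x0, fun _ _ => rfl⟩,
    ⟨x1, fun _ _ => rfl⟩, h0 _, h0 _, ?_⟩
  rw [Set.disjoint_left]
  intro y hy hy'
  have h1 := hy n (by omega)
  have h2 := hy' n (by omega)
  simp [x0, x1] at h1 h2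
  simp [h1] at h2

/-- `f` vanishes off `U` -/
def Sup (U : Set CantorSet) (f : LL) : Prop := ∀ x, x ∉ U → (f : CantorC) x = 0

theorem Sup.mono {U V : Set CantorSet} (h : U ⊆ V) {f : LL} (hf : Sup U f) : Sup V f :=
  fun x hx => hf x fun hx' => hx (h hx')

theorem Sup.smul {U : Set CantorSet} {f : LL} (hf : Sup U f) (c : ℝ) : Sup U (c • f) :=
  fun x hx => by simp [hf x hx]

theorem Sup.add {U : Set CantorSet} {f g : LL} (hf : Sup U f) (hg : Sup U g) : Sup U (f + g) :=
  fun x hx => by simp [hf x hx, hg x hx]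

theorem exists_bump {U : Set CantorSet} (hU : IsOpen U) (hne : U.Nonempty) :
    ∃ g : LL, Sup U g ∧ (∀ x, |(g : CantorC) x| ≤ 1) ∧ ∃ x, (g : CantorC) x = 1 := by
  obtain ⟨x, hx⟩ := hne
  obtain ⟨n, hn⟩ := exists_cyl hU hx
  refine ⟨⟨cylInd n x, n, cylInd_mem n x⟩, ?_, ?_, x, ?_⟩
  · intro y hy
    have : y ∉ cyl n x := fun h => hy (hn h)
    simp [cylInd, this]
  · intro y
    simp only [cylInd, ContinuousMap.coe_mk]
    split_ifs <;> simp
  · have : x ∈ cyl n x := fun _ _ => rfl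
    simp [cylInd, this]

theorem norm_LL (f : LL) : ‖f‖ = ‖(f : CantorC)‖ := rfl

theorem LL_abs_le (f : LL) (x : CantorSet) : |(f : CantorC) x| ≤ ‖f‖ :=
  (f : CantorC).norm_coe_le_norm x

theorem LL_norm_le (f : LL) {b : ℝ} (hb : 0 ≤ b) (h : ∀ x, |(f : CantorC) x| ≤ b) : ‖f‖ ≤ b :=
  (ContinuousMap.norm_le _ hb).2 h

theorem exists_norm_attain (f : LL) : ∃ x, |(f : CantorC) x| = ‖f‖ := by
  obtain ⟨x, -, hx⟩ := (isCompact_univ (X := CantorSet)).exists_isMaxOn Set.univ_nonempty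
    ((f : CantorC).continuous.abs.continuousOn)
  refine ⟨x, le_antisymm (LL_abs_le f x) (LL_norm_le f (abs_nonneg _) fun y => ?_)⟩
  exact hx (Set.mem_univ y)

/-- normalise -/
theorem exists_normalise (f : LL) (hf : f ≠ 0) :
    ∃ c : ℝ, |c| = ‖f‖⁻¹ ∧ (∀ x, |((c • f : LL) : CantorC) x| ≤ 1) ∧
      ∃ x, ((c • f : LL) : CantorC) x = 1 := by
  obtain ⟨x, hx⟩ := exists_norm_attain f
  have hpos : 0 < ‖f‖ := norm_pos_iff.2 hf
  have hne : (f : CantorC) x ≠ 0 := by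
    intro h; rw [h, abs_zero] at hx; exact hpos.ne hx
  refine ⟨((f : CantorC) x)⁻¹, by rw [abs_inv, hx], fun y => ?_, x, ?_⟩
  · simp only [Submodule.coe_smul, ContinuousMap.coe_smul, Pi.smul_apply, smul_eq_mul, abs_mul,
      abs_inv, hx]
    rw [inv_mul_le_iff₀ hpos, mul_one]
    exact LL_abs_le f y
  · simp [hne]

theorem dense_LL : Dense (LL : Set CantorC) := by
  let A : Subalgebra ℝ CantorC :=
    { carrier := LL
      mul_mem' := by
        rintro a b ⟨n, hn⟩ ⟨m, hm⟩
        refine ⟨max n m, ?_⟩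
        have h1 := SS_mono (le_max_left n m) hn
        have h2 := SS_mono (le_max_right n m) hm
        rw [mem_SS] at *
        ext x
        have e1 := DFunLike.congr_fun h1 x
        have e2 := DFunLike.congr_fun h2 x
        simp only [rr_apply] at e1 e2
        simp [e1, e2]
      add_mem' := fun ha hb => LL.add_mem ha hb
      algebraMap_mem' := fun r => ⟨0, by rw [mem_SS]; ext x; simp [Algebra.algebraMap_eq_smul_one]⟩ }
  have hA : A.SeparatesPoints := by
    intro x y hxy
    obtain ⟨i, hi⟩ := Function.ne_iff.1 hxy
    refine ⟨cylInd (i+1) x, ⟨cylInd (i+1) x, ⟨i+1, cylInd_mem _ _⟩, rfl⟩, ?_⟩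
    have h1 : x ∈ cyl (i+1) x := fun _ _ => rfl
    have h2 : y ∉ cyl (i+1) x := fun h => hi (h i (by omega)).symm
    simp [cylInd, h1, h2]
  have := ContinuousMap.subalgebra_topologicalClosure_eq_top_of_separatesPoints A hA
  intro f
  have hf : f ∈ A.topologicalClosure := by rw [this]; trivial
  exact hf

/-! ### points and coefficients -/
def qq (k : ℕ) : CantorSet := fun i => k.testBit i

def par (k : ℕ) : ℕ := k % 2 ^ Nat.log2 k

theorem par_lt {k : ℕ} (hk : 0 < k) : par k < k := by
  have h1 : 2 ^ Nat.log2 k ≤ k := Nat.log2_self_le hk.ne'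
  exact lt_of_lt_of_le (Nat.mod_lt _ (by positivity)) h1

theorem SS_par {n : ℕ} {f : CantorC} (hf : f ∈ SS n) {k : ℕ} (hk : 2 ^ n ≤ k) :
    f (qq k) = f (qq (par k)) := by
  refine SS_apply hf fun i hi => ?_
  have hk0 : k ≠ 0 := by have : 0 < 2 ^ n := by positivity
                         omega
  have : n ≤ Nat.log2 k := (Nat.le_log2 hk0).2 hk
  simp only [qq, par, Nat.testBit_mod_two_pow]
  have h3 : i < Nat.log2 k := by omega
  simp [h3]

def coef (v : ℕ → ℝ) (k : ℕ) : ℝ := if k = 0 then v 0 else v k - v (par k)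

theorem exists_qq {f : CantorC} (hf : f ∈ LL) (x : CantorSet) : ∃ k, f x = f (qq k) := by
  obtain ⟨n, hn⟩ := hf
  refine ⟨Nat.ofBits (fun i : Fin n => x i), SS_apply hn fun i hi => ?_⟩
  simp only [qq]
  rw [Nat.testBit_ofBits_lt _ _ hi]

theorem LL_norm_le_qq (f : LL) {b : ℝ} (h : ∀ k, |(f : CantorC) (qq k)| ≤ b) : ‖f‖ ≤ b := by
  refine LL_norm_le f ((abs_nonneg _).trans (h 0)) fun x => ?_
  obtain ⟨k, hk⟩ := exists_qq f.2 x
  rw [hk]; exact h k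

theorem coef_finite (f : LL) : (Function.support (coef fun k => (f : CantorC) (qq k))).Finite := by
  obtain ⟨n, hn⟩ := f.2
  refine (Set.finite_lt_nat (2 ^ n)).subset fun k hk => ?_
  by_contra hlt
  simp only [Set.mem_ofPred_eq, not_lt] at hlt
  apply hk
  have : k ≠ 0 := by
    have : 0 < 2 ^ n := by positivity
    omega
  simp only [coef, this, if_false]
  rw [SS_par hn hlt, sub_self]

def aa : LL →ₗ[ℝ] (ℕ →₀ ℝ) where
  toFun f := Finsupp.ofSupportFinite _ (coef_finite f)
  map_add' f g := by
    ext k; simp only [Finsupp.ofSupportFinite_coe, Finsupp.add_apply, coef]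
    split_ifs <;> simp; ring
  map_smul' c f := by
    ext k; simp only [Finsupp.ofSupportFinite_coe, Finsupp.smul_apply, coef]
    split_ifs <;> simp; ring

theorem aa_apply (f : LL) (k : ℕ) : aa f k = coef (fun k => (f : CantorC) (qq k)) k := rfl

theorem abs_aa_le (f : LL) (k : ℕ) : |aa f k| ≤ 2 * ‖f‖ := by
  rw [aa_apply, coef]
  have h0 := norm_nonneg f
  split_ifs
  · linarith [LL_abs_le f (qq 0)]
  · exact (abs_sub _ _).trans (by linarith [LL_abs_le f (qq k), LL_abs_le f (qq (par k))])

variable {V : Type*} [AddCommGroup V] [Module ℝ V]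

def Phi (z : ℕ → V) : LL →ₗ[ℝ] V := (Finsupp.linearCombination ℝ z) ∘ₗ aa

theorem Phi_apply (z : ℕ → V) (f : LL) : Phi z f = (aa f).sum fun k c => c • z k := rfl

theorem Phi_eq_sum (z : ℕ → V) (f : LL) {m : ℕ} (hm : ∀ k, m ≤ k → aa f k = 0) :
    Phi z f = ∑ k ∈ Finset.range m, aa f k • z k := by
  rw [Phi_apply, Finsupp.sum_of_support_subset _ _ _ (by simp)]
  intro k hk
  rw [Finset.mem_range]
  by_contra h
  exact (Finsupp.mem_support_iff.1 hk) (hm k (not_lt.1 h))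

theorem exists_bound (f : LL) : ∃ m, ∀ k, m ≤ k → aa f k = 0 := by
  refine ⟨(aa f).support.sup id + 1, fun k hk => ?_⟩
  by_contra h
  have := Finset.le_sup (f := id) (Finsupp.mem_support_iff.2 h)
  simp at this; omega

theorem map_Phi {W : Type*} [AddCommGroup W] [Module ℝ W] (T : V →ₗ[ℝ] W) (z : ℕ → V) (f : LL) :
    T (Phi z f) = Phi (fun k => T (z k)) f := by
  simp only [Phi_apply, Finsupp.sum, map_sum, map_smul]

theorem Phi_sub (z w : ℕ → V) (f : LL) : Phi z f - Phi w f = Phi (fun k => z k - w k) f := by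
  simp only [Phi_apply, Finsupp.sum, ← Finset.sum_sub_distrib, smul_sub]

/-- small systems give small operators; `p` any seminorm -/
theorem Phi_small (p : Seminorm ℝ V) (z : ℕ → V) {ε : ℝ} (hz : ∀ k, p (z k) ≤ ε / 4 * (1/2)^k)
    (hε : 0 ≤ ε) (f : LL) : p (Phi z f) ≤ ε * ‖f‖ := by
  obtain ⟨m, hm⟩ := exists_bound f
  rw [Phi_eq_sum z f hm]
  have h1 : p (∑ k ∈ Finset.range m, aa f k • z k) ≤
      ∑ k ∈ Finset.range m, p (aa f k • z k) := by
    apply Finset.le_sum_of_subadditive (p : V → ℝ) (map_zero p).le (map_add_le_add p)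
  refine h1.trans ?_
  have h2 : ∀ k ∈ Finset.range m, p (aa f k • z k) ≤ (ε / 2 * ‖f‖) * (1/2)^k := by
    intro k _
    rw [map_smul_eq_mul, Real.norm_eq_abs]
    calc |aa f k| * p (z k) ≤ (2 * ‖f‖) * (ε / 4 * (1/2)^k) := by
          gcongr
          · exact abs_aa_le f k
          · exact hz k
      _ = _ := by ring
  refine (Finset.sum_le_sum h2).trans ?_
  rw [← Finset.mul_sum]
  have h3 : ∑ k ∈ Finset.range m, (1/2 : ℝ)^k ≤ 2 := sum_geometric_two_le m
  calc ε / 2 * ‖f‖ * ∑ k ∈ Finset.range m, (1/2 : ℝ)^k ≤ ε / 2 * ‖f‖ * 2 := by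
        gcongr
    _ = _ := by ring

/-! ### Lemma A -/
def InvA (U0 : Set CantorSet) (Pr : ℕ → LL → Prop) (m : ℕ)
    (s : (ℕ → LL) × (ℕ → Set CantorSet)) : Prop :=
  (∀ i < m, IsOpen (s.2 i) ∧ (s.2 i).Nonempty ∧ s.2 i ⊆ U0) ∧
  (∀ i < m, Pr i (s.1 i) ∧ Sup U0 (s.1 i)) ∧
  ∀ (v : ℕ → ℝ) (b : ℝ), 0 ≤ b → (∀ i, |v i| ≤ b) →
    (∀ x, |∑ k ∈ Finset.range m, coef v k * (s.1 k : CantorC) x| ≤ 3 * b) ∧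
    (∀ i < m, ∀ x ∈ s.2 i, ∑ k ∈ Finset.range m, coef v k * (s.1 k : CantorC) x = v i)

theorem lemmaA (Pr : ℕ → LL → Prop)
    (hPr : ∀ k U, IsOpen U → U.Nonempty → ∃ g : LL, Sup U g ∧ (∀ x, |(g : CantorC) x| ≤ 1) ∧
      (∃ x, (g : CantorC) x = 1) ∧ Pr k g)
    {U0 : Set CantorSet} (hU0 : IsOpen U0) (hne : U0.Nonempty) :
    ∃ g : ℕ → LL, (∀ k, Pr k (g k)) ∧ ∀ f, ‖f‖ ≤ ‖Phi g f‖ ∧ ‖Phi g f‖ ≤ 3 * ‖f‖ ∧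
      Sup U0 (Phi g f) := by
  classical
  obtain ⟨s, hs⟩ := dchoice (InvA U0 Pr) (fun m s t => ∀ k < m, t.1 k = s.1 k)
    ⟨(fun _ => 0, fun _ => ∅), by simp, by simp, fun v b hb _ => by simp [hb]⟩ (by
      rintro m ⟨g, A⟩ ⟨hA, hP, hF⟩
      simp only at hA hP hF
      rcases Nat.eq_zero_or_pos m with rfl | hm
      · obtain ⟨h, h1, h2, h3, h4⟩ := hPr 0 U0 hU0 hne
        refine ⟨(fun _ => h, fun _ => {x | (h : CantorC) x = 1}), ⟨?_, ?_, ?_⟩, by simp⟩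
        · intro i _
          refine ⟨isOpen_level h.2 1, h3, fun x hx => ?_⟩
          by_contra hxU
          have := h1 x hxU
          simp only [Set.mem_ofPred_eq] at hx
          rw [hx] at this; norm_num at this
        · intro i hi
          obtain rfl : i = 0 := by omega
          exact ⟨h4, h1⟩
        · intro v b hb hv
          simp only [zero_add, Finset.range_one, Finset.sum_singleton, coef, if_true]
          constructor
          · intro x
            rw [abs_mul]
            have := mul_le_mul (hv 0) (h2 x) (abs_nonneg _) hb
            linarith
          · intro i hi x hx
            obtain rfl : i = 0 := by omega
            simp only [Set.mem_ofPred_eq] at hx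
            rw [hx, mul_one]
      · have hj := par_lt hm
        set j := par m with hjdef
        obtain ⟨hAo, hAn, hAU⟩ := hA j hj
        obtain ⟨V, W, hV, hW, hVn, hWn, hVA, hWA, hVW⟩ := split_open hAo hAn
        obtain ⟨h, h1, h2, h3, h4⟩ := hPr m V hV hVn
        have hlev : {x | (h : CantorC) x = 1} ⊆ V := by
          intro x hx
          by_contra hxU
          have := h1 x hxU
          simp only [Set.mem_ofPred_eq] at hx
          rw [hx] at this; norm_num at this
        have hdis : ∀ i < m, i ≠ j → ∀ x ∈ A i, x ∉ A j := by
          intro i hi hij x hxi hxj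
          have hb := hF (fun l => if l = i then 1 else 0) 1 zero_le_one (by
            intro l; split_ifs <;> simp)
          have e1 := hb.2 i hi x hxi
          have e2 := hb.2 j hj x hxj
          rw [e1] at e2
          simp [Ne.symm hij] at e2
        refine ⟨(Function.update g m h, Function.update (Function.update A j W) m
          {x | (h : CantorC) x = 1}), ⟨?_, ?_, ?_⟩, ?_⟩
        · intro i hi
          simp only
          by_cases him : i = m
          · subst him
            rw [Function.update_self]
            exact ⟨isOpen_level h.2 1, h3, hlev.trans (hVA.trans hAU)⟩
          · rw [Function.update_of_ne him]
            by_cases hij : i = j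
            · rw [hij, Function.update_self]
              exact ⟨hW, hWn, hWA.trans hAU⟩
            · rw [Function.update_of_ne hij]
              exact hA i (by omega)
        · intro i hi
          simp only
          by_cases him : i = m
          · subst him
            rw [Function.update_self]
            exact ⟨h4, h1.mono (hVA.trans hAU)⟩
          · rw [Function.update_of_ne him]
            exact hP i (by omega)
        · intro v b hb hv
          obtain ⟨hF1, hF2⟩ := hF v b hb hv
          have hsum : ∀ x, ∑ k ∈ Finset.range (m+1), coef v k *
              (((Function.update g m h) k : LL) : CantorC) x =
              ∑ k ∈ Finset.range m, coef v k * (g k : CantorC) x +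
                (v m - v j) * (h : CantorC) x := by
            intro x
            rw [Finset.sum_range_succ, Function.update_self]
            congr 1
            · refine Finset.sum_congr rfl fun k hk => ?_
              rw [Function.update_of_ne (Finset.mem_range.1 hk).ne]
            · simp [coef, hm.ne']; left; rfl
          simp only [hsum]
          constructor
          · intro x
            by_cases hxV : x ∈ V
            · rw [hF2 j hj x (hVA hxV)]
              have e1 : |(v m - v j) * (h : CantorC) x| ≤ (b + b) * 1 := by
                rw [abs_mul]
                exact mul_le_mul ((abs_sub _ _).trans (add_le_add (hv _) (hv _))) (h2 x)
                  (abs_nonneg _) (by linarith)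
              have := abs_add_le (v j) ((v m - v j) * (h : CantorC) x)
              linarith [hv j]
            · rw [h1 x hxV, mul_zero, add_zero]
              exact hF1 x
          · intro i hi x hx
            by_cases him : i = m
            · subst him
              rw [Function.update_self] at hx
              rw [hF2 j hj x (hVA (hlev hx))]
              simp only [Set.mem_ofPred_eq] at hx
              rw [hx]; ring
            · rw [Function.update_of_ne him] at hx
              by_cases hij : i = j
              · rw [hij, Function.update_self] at hx
                rw [hij, hF2 j hj x (hWA hx), h1 x (fun h' => Set.disjoint_left.1 hVW h' hx)]
                ring
              · rw [Function.update_of_ne hij] at hx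
                rw [hF2 i (by omega) x hx, h1 x fun h' => hdis i (by omega) hij x hx (hVA h')]
                ring
        · intro k hk
          simp only
          rw [Function.update_of_ne hk.ne])
  have hstab : ∀ k m, k < m → (s m).1 k = (s (k+1)).1 k := by
    intro k m hkm
    induction m, hkm using Nat.le_induction with
    | base => rfl
    | succ m hm ih => rw [(hs m).2 k hm, ih]
  have hU : ∀ k, Pr k ((s (k+1)).1 k) ∧ Sup U0 ((s (k+1)).1 k) := fun k =>
    (hs (k+1)).1.2.1 k (by omega)
  refine ⟨fun k => (s (k+1)).1 k, fun k => (hU k).1, fun f => ?_⟩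
  have hval : ∀ m x, (∀ k, m ≤ k → aa f k = 0) →
      ((Phi (fun k => (s (k+1)).1 k) f : LL) : CantorC) x =
      ∑ k ∈ Finset.range m, coef (fun k => (f : CantorC) (qq k)) k * ((s m).1 k : CantorC) x := by
    intro m x hm
    rw [Phi_eq_sum _ _ hm]
    simp only [Submodule.coe_sum, ContinuousMap.coe_sum, Finset.sum_apply, Submodule.coe_smul,
      ContinuousMap.coe_smul, Pi.smul_apply, smul_eq_mul]
    refine Finset.sum_congr rfl fun k hk => ?_
    rw [hstab k m (Finset.mem_range.1 hk)]; rfl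
  obtain ⟨m, hm⟩ := exists_bound f
  refine ⟨?_, ?_, ?_⟩
  · refine LL_norm_le_qq f fun i => ?_
    have hm' : ∀ k, max m (i+1) ≤ k → aa f k = 0 := fun k hk => hm k (by omega)
    obtain ⟨hA, -, hF⟩ := (hs (max m (i+1))).1
    obtain ⟨x, hx⟩ := (hA i (by omega)).2.1
    have h1 := (hF (fun k => (f : CantorC) (qq k)) ‖f‖ (norm_nonneg _)
      (fun k => LL_abs_le f _)).2 i (by omega) x hx
    rw [← hval _ _ hm'] at h1
    rw [← h1]
    exact LL_abs_le _ _
  · refine LL_norm_le _ (by positivity) fun x => ?_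
    rw [hval m x hm]
    exact ((hs m).1.2.2 (fun k => (f : CantorC) (qq k)) ‖f‖ (norm_nonneg _)
      (fun k => LL_abs_le f _)).1 x
  · intro x hx
    rw [Phi_eq_sum _ _ hm]
    simp only [Submodule.coe_sum, ContinuousMap.coe_sum, Finset.sum_apply, Submodule.coe_smul,
      ContinuousMap.coe_smul, Pi.smul_apply, smul_eq_mul]
    refine Finset.sum_eq_zero fun k _ => ?_
    rw [(hU k).2 x hx, mul_zero]

/-! ### extension of embeddings -/
theorem extEmb {M X V : Type*} [AddCommGroup M] [Module ℝ M] [NormedAddCommGroup X]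
    [NormedSpace ℝ X] [NormedAddCommGroup V] [NormedSpace ℝ V] [CompleteSpace V]
    (P : M →ₗ[ℝ] X) (hP : DenseRange P) (R : M →ₗ[ℝ] V) {c C : ℝ} (hc : 0 < c)
    (h1 : ∀ m, c * ‖P m‖ ≤ ‖R m‖) (h2 : ∀ m, ‖R m‖ ≤ C * ‖P m‖) : Embeds X V := by
  have hker : LinearMap.ker P ≤ LinearMap.ker R := by
    intro m hm
    rw [LinearMap.mem_ker] at *
    have := h2 m
    rw [hm, norm_zero, mul_zero] at this
    exact norm_le_zero_iff.1 this
  let S : LinearMap.range P →ₗ[ℝ] V :=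
    ((LinearMap.ker P).liftQ R hker) ∘ₗ (P.quotKerEquivRange.symm : _ →ₗ[ℝ] _)
  have hS : ∀ m, S ⟨P m, m, rfl⟩ = R m := by
    intro m
    have : P.quotKerEquivRange.symm ⟨P m, m, rfl⟩ = Submodule.Quotient.mk m := by
      rw [LinearEquiv.symm_apply_eq]; rfl
    simp only [S, LinearMap.comp_apply, LinearEquiv.coe_coe, this]
    exact Submodule.liftQ_apply _ _ _
  let S' : LinearMap.range P →L[ℝ] V := S.mkContinuous C (by
    rintro ⟨_, m, rfl⟩
    rw [hS]; exact h2 m)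
  let T : X →L[ℝ] V := S'.extend (LinearMap.range P).subtypeL
  have hd : DenseRange (LinearMap.range P).subtypeL := by
    have : Set.range (LinearMap.range P).subtypeL = Set.range P := by
      ext x; simp
    rw [DenseRange, this]; exact hP
  have hu : IsUniformInducing (LinearMap.range P).subtypeL := isUniformEmbedding_subtype_val.isUniformInducing
  have hT : ∀ m, T (P m) = R m := by
    intro m
    have := S'.extend_eq hd hu ⟨P m, m, rfl⟩
    rw [← hS m]; exact this
  refine ⟨T, c, hc, fun x => ?_⟩
  refine hP.induction_on (p := fun x => c * ‖x‖ ≤ ‖T x‖) x ?_ ?_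
  · exact isClosed_le (by fun_prop) (by fun_prop)
  · intro m; rw [hT]; exact h1 m

end
end BB

namespace BB
noncomputable section

abbrev Sq := ℕ →₀ CantorC

theorem sq_bound (s : Sq) : ∃ M, ∀ n, M ≤ n → s n = 0 := by
  refine ⟨s.support.sup id + 1, fun k hk => ?_⟩
  by_contra h
  have := Finset.le_sup (f := id) (Finsupp.mem_support_iff.2 h)
  simp at this; omega

theorem supp_sub_range {s : Sq} {M : ℕ} (h : ∀ n, M ≤ n → s n = 0) :
    s.support ⊆ Finset.range M := by
  intro n hn
  rw [Finset.mem_range]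
  by_contra h'
  exact Finsupp.mem_support_iff.1 hn (h n (not_lt.1 h'))

def mkF (g : ℕ → CantorC) (h : ∃ M, ∀ n, M ≤ n → g n = 0) : Sq :=
  Finsupp.ofSupportFinite g (by
    obtain ⟨M, hM⟩ := h
    refine (Set.finite_lt_nat M).subset fun n hn => ?_
    by_contra hlt
    exact hn (hM n (not_lt.1 hlt)))

@[simp] theorem mkF_apply (g : ℕ → CantorC) (h : ∃ M, ∀ n, M ≤ n → g n = 0) (n : ℕ) :
    mkF g h n = g n := rfl

/-- difference operator -/
def DD : Sq →ₗ[ℝ] Sq where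
  toFun s := mkF (fun n => rr n (s n - s (n+1))) (by
    obtain ⟨M, hM⟩ := sq_bound s
    exact ⟨M, fun n hn => by rw [hM n hn, hM (n+1) (by omega)]; simp⟩)
  map_add' s t := by
    ext1 n
    simp only [mkF_apply, Finsupp.add_apply, map_add, map_sub]; abel
  map_smul' c s := by
    ext1 n
    simp only [mkF_apply, Finsupp.smul_apply, map_smul, map_sub, RingHom.id_apply, smul_sub]

@[simp] theorem DD_apply (s : Sq) (n : ℕ) : DD s n = rr n (s n - s (n+1)) := rfl

/-- sum of the coordinates -/
def sm : Sq →ₗ[ℝ] CantorC := Finsupp.lsum ℝ fun _ => LinearMap.id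

theorem sm_eq {s : Sq} {M : ℕ} (h : ∀ n, M ≤ n → s n = 0) :
    sm s = ∑ n ∈ Finset.range M, s n := by
  simp only [sm, Finsupp.lsum_apply]
  rw [Finsupp.sum_of_support_subset _ (supp_sub_range h) _ (by simp)]
  rfl

/-- ell one norm -/
def l1 (s : Sq) : ℝ := ∑ n ∈ s.support, ‖s n‖

theorem l1_eq {s : Sq} {M : ℕ} (h : ∀ n, M ≤ n → s n = 0) :
    l1 s = ∑ n ∈ Finset.range M, ‖s n‖ := by
  refine Finset.sum_subset (supp_sub_range h) fun n _ hn => ?_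
  simp [Finsupp.notMem_support_iff.1 hn]

theorem l1_nonneg (s : Sq) : 0 ≤ l1 s := Finset.sum_nonneg fun _ _ => norm_nonneg _

theorem two_bound (s t : Sq) : ∃ M, (∀ n, M ≤ n → s n = 0) ∧ (∀ n, M ≤ n → t n = 0) := by
  obtain ⟨M, hM⟩ := sq_bound s
  obtain ⟨M', hM'⟩ := sq_bound t
  exact ⟨max M M', fun n hn => hM n (by omega), fun n hn => hM' n (by omega)⟩

theorem l1_add_le (s t : Sq) : l1 (s + t) ≤ l1 s + l1 t := by
  obtain ⟨M, h1, h2⟩ := two_bound s t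
  rw [l1_eq h1, l1_eq h2, l1_eq (s := s + t) (M := M) (fun n hn => by simp [h1 n hn, h2 n hn]),
    ← Finset.sum_add_distrib]
  exact Finset.sum_le_sum fun n _ => norm_add_le _ _

theorem l1_smul (c : ℝ) (s : Sq) : l1 (c • s) = |c| * l1 s := by
  obtain ⟨M, h1⟩ := sq_bound s
  rw [l1_eq h1, l1_eq (s := c • s) (M := M) (fun n hn => by simp [h1 n hn]), Finset.mul_sum]
  exact Finset.sum_congr rfl fun n _ => by simp [norm_smul]

theorem norm_sm_le (s : Sq) : ‖sm s‖ ≤ l1 s := by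
  obtain ⟨M, h1⟩ := sq_bound s
  rw [sm_eq h1, l1_eq h1]
  exact norm_sum_le _ _

def WW (X : ℕ → Submodule ℝ CantorC) : Submodule ℝ Sq where
  carrier := {w | ∀ n, w n ∈ X n}
  add_mem' := fun ha hb n => (X n).add_mem (ha n) (hb n)
  zero_mem' := fun n => (X n).zero_mem
  smul_mem' := fun c _ ha n => (X n).smul_mem c (ha n)

theorem mem_WW {X : ℕ → Submodule ℝ CantorC} {w : Sq} : w ∈ WW X ↔ ∀ n, w n ∈ X n := Iff.rfl

def cost (s w : Sq) : ℝ := ‖sm w‖ + l1 (DD s - w)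

theorem cost_nonneg (s w : Sq) : 0 ≤ cost s w := add_nonneg (norm_nonneg _) (l1_nonneg _)

def Hf (X : ℕ → Submodule ℝ CantorC) (s : Sq) : ℝ := ⨅ w : WW X, cost s w

variable {X : ℕ → Submodule ℝ CantorC}

theorem Hf_bdd (s : Sq) : BddBelow (Set.range fun w : WW X => cost s w) :=
  ⟨0, by rintro _ ⟨w, rfl⟩; exact cost_nonneg _ _⟩

theorem Hf_le {s w : Sq} (hw : w ∈ WW X) : Hf X s ≤ cost s w :=
  ciInf_le (Hf_bdd s) (⟨w, hw⟩ : WW X)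

theorem Hf_nonneg (s : Sq) : 0 ≤ Hf X s := le_ciInf fun _ => cost_nonneg _ _

theorem Hf_lt {s : Sq} {r : ℝ} (h : Hf X s < r) : ∃ w ∈ WW X, cost s w < r := by
  obtain ⟨w, hw⟩ := exists_lt_of_ciInf_lt h
  exact ⟨w, w.2, hw⟩

theorem le_Hf {s : Sq} {r : ℝ} (h : ∀ w ∈ WW X, r ≤ cost s w) : r ≤ Hf X s :=
  le_ciInf fun w => h w w.2

theorem Hf_add (s t : Sq) : Hf X (s + t) ≤ Hf X s + Hf X t := by
  refine le_of_forall_pos_lt_add fun ε hε => ?_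
  obtain ⟨w, hw, h1⟩ := Hf_lt (show Hf X s < Hf X s + ε/2 by linarith)
  obtain ⟨u, hu, h2⟩ := Hf_lt (show Hf X t < Hf X t + ε/2 by linarith)
  refine (Hf_le ((WW X).add_mem hw hu)).trans_lt ?_
  have h3 : cost (s + t) (w + u) ≤ cost s w + cost t u := by
    simp only [cost, map_add]
    have e : DD s + DD t - (w + u) = (DD s - w) + (DD t - u) := by abel
    rw [e]
    have := norm_add_le (sm w) (sm u)
    have := l1_add_le (DD s - w) (DD t - u)
    linarith
  linarith

theorem cost_smul (c : ℝ) (s w : Sq) : cost (c • s) (c • w) = |c| * cost s w := by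
  simp only [cost, map_smul, norm_smul, ← smul_sub, l1_smul, Real.norm_eq_abs]; ring

def Hn (X : ℕ → Submodule ℝ CantorC) : Seminorm ℝ Sq :=
  Seminorm.ofSMulLE (Hf X) (le_antisymm ((Hf_le (WW X).zero_mem).trans (by simp [cost, l1]))
    (Hf_nonneg _)) Hf_add (by
    intro c s
    rcases eq_or_ne c 0 with rfl | hc
    · rw [zero_smul]
      refine (Hf_le (WW X).zero_mem).trans ?_
      simp [cost, l1]
    · have hc' : 0 < |c| := abs_pos.2 hc
      rw [Real.norm_eq_abs, ← div_le_iff₀' hc']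
      refine le_Hf fun w hw => ?_
      rw [div_le_iff₀' hc', ← cost_smul]
      exact Hf_le ((WW X).smul_mem c hw))

theorem Hn_apply (s : Sq) : Hn X s = Hf X s := rfl

theorem Hn_le_l1 (s : Sq) : Hn X s ≤ l1 (DD s) :=
  (Hf_le (WW X).zero_mem).trans (by simp [cost])

theorem le_Hn (s : Sq) : ‖sm (DD s)‖ ≤ Hn X s := by
  refine le_Hf fun w _ => ?_
  have h := norm_add_le (sm w) (sm (DD s - w))
  rw [← map_add, add_sub_cancel] at h
  have := norm_sm_le (DD s - w)
  simp only [cost]; linarith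

theorem Hn_of_mem (s : Sq) (h : DD s ∈ WW X) : Hn X s = ‖sm (DD s)‖ :=
  le_antisymm ((Hf_le h).trans (by simp [cost, l1])) (le_Hn s)

theorem DD_filter_sum (s : Sq) (L M : ℕ) (h : L ≤ M) :
    ∑ k ∈ Finset.Ico L M, rr L (DD s k) = rr L (s L) - rr L (s M) := by
  induction M, h using Nat.le_induction with
  | base => simp
  | succ M hM ih =>
    rw [Finset.sum_Ico_succ_top hM, ih, DD_apply, rr_rr, min_eq_left hM, map_sub]
    abel

def cut (L : ℕ) (s : Sq) : Sq := s.filter (· ≤ L)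

theorem cut_apply (L : ℕ) (s : Sq) (n : ℕ) : cut L s n = if n ≤ L then s n else 0 :=
  Finsupp.filter_apply _ _ _

theorem Hn_cut_le {X X' : ℕ → Submodule ℝ CantorC} (hX : ∀ n, X n ≤ SS n) (hm : Monotone X')
    (L : ℕ) (h : ∀ k ≤ L, X k ≤ X' k) (s : Sq) : Hn X' (cut L s) ≤ Hn X s := by
  refine le_Hf fun w hw => ?_
  let w' : Sq := mkF (fun k => if k < L then w k else if k = L then
    -∑ i ∈ Finset.range L, w i else 0) ⟨L+1, fun n hn => by
      rw [if_neg (by omega), if_neg (by omega)]⟩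
  have hw' : w' ∈ WW X' := by
    intro k
    simp only [w', mkF_apply]
    split_ifs with h1 h2
    · exact h k h1.le (hw k)
    · refine Submodule.neg_mem _ (Submodule.sum_mem _ fun i hi => ?_)
      have hi := Finset.mem_range.1 hi
      exact hm (show i ≤ k by omega) (h i (by omega) (hw i))
    · exact zero_mem _
  refine (Hf_le hw').trans ?_
  have hsm : sm w' = 0 := by
    rw [sm_eq (M := L+1) (fun n hn => by
      simp only [w', mkF_apply]
      rw [if_neg (by omega), if_neg (by omega)]), Finset.sum_range_succ]
    have e : ∑ n ∈ Finset.range L, w' n = ∑ n ∈ Finset.range L, w n :=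
      Finset.sum_congr rfl fun n hn => by simp [w', Finset.mem_range.1 hn]
    rw [e]; simp [w']
  have hl : l1 (DD (cut L s) - w') = ∑ n ∈ Finset.range L, ‖(DD s - w) n‖ +
      ‖rr L (s L) + ∑ i ∈ Finset.range L, w i‖ := by
    rw [l1_eq (M := L+1) (fun n hn => by
      simp only [w', Finsupp.sub_apply, DD_apply, cut_apply, mkF_apply]
      rw [if_neg (by omega), if_neg (by omega), if_neg (by omega), if_neg (by omega)]; simp),
      Finset.sum_range_succ]
    congr 1
    · refine Finset.sum_congr rfl fun n hn => ?_
      have hn := Finset.mem_range.1 hn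
      simp only [w', Finsupp.sub_apply, DD_apply, cut_apply, mkF_apply]
      rw [if_pos (by omega), if_pos (by omega), if_pos (by omega)]
    · simp [w', cut_apply]
  obtain ⟨M0, hM1, hM2⟩ := two_bound s w
  set M := max M0 (L+1)
  have h1 : ∀ n, M ≤ n → s n = 0 := fun n hn => hM1 n (by omega)
  have h2 : ∀ n, M ≤ n → w n = 0 := fun n hn => hM2 n (by omega)
  have hLM : L ≤ M := by omega
  have hl2 : l1 (DD s - w) = ∑ n ∈ Finset.range L, ‖(DD s - w) n‖ +
      ∑ n ∈ Finset.Ico L M, ‖(DD s - w) n‖ := by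
    rw [l1_eq (M := M) (fun n hn => by simp [h1 n hn, h2 n hn, h1 (n+1) (by omega)]),
      Finset.sum_range_add_sum_Ico _ hLM]
  have key : rr L (s L) + ∑ i ∈ Finset.range L, w i =
      rr L (∑ n ∈ Finset.Ico L M, (DD s - w) n + sm w) := by
    rw [sm_eq h2, ← Finset.sum_range_add_sum_Ico _ hLM]
    have e1 : rr L (∑ i ∈ Finset.range L, w i) = ∑ i ∈ Finset.range L, w i := by
      rw [← mem_SS]
      exact Submodule.sum_mem _ fun i hi => SS_mono (Finset.mem_range.1 hi).le (hX i (hw i))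
    have e2 : rr L (∑ n ∈ Finset.Ico L M, DD s n) = rr L (s L) := by
      rw [map_sum, DD_filter_sum s L M hLM, h1 M le_rfl]; simp
    simp only [Finsupp.sub_apply, Finset.sum_sub_distrib]
    rw [map_add, map_sub, map_add, e1, e2]; abel
  have h3 : ‖rr L (s L) + ∑ i ∈ Finset.range L, w i‖ ≤
      ∑ n ∈ Finset.Ico L M, ‖(DD s - w) n‖ + ‖sm w‖ := by
    rw [key]
    exact (norm_rr_le _ _).trans ((norm_add_le _ _).trans (add_le_add_left (norm_sum_le _ _) _))
  simp only [cost]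
  rw [hsm, hl, hl2, norm_zero]
  linarith

def tl (m : ℕ) : Sq →ₗ[ℝ] Sq where
  toFun s := s.filter (m ≤ ·)
  map_add' _ _ := Finsupp.filter_add
  map_smul' c s := by simp [Finsupp.filter_smul]

theorem tl_apply (m : ℕ) (s : Sq) (n : ℕ) : tl m s n = if m ≤ n then s n else 0 :=
  Finsupp.filter_apply _ _ _

theorem tl_zero (s : Sq) : tl 0 s = s := by ext1 n; simp [tl_apply]

theorem tl_succ (L : ℕ) (s : Sq) : cut L s + tl (L+1) s = s := by
  ext1 n
  rw [Finsupp.add_apply, cut_apply, tl_apply]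
  by_cases h : n ≤ L
  · rw [if_pos h, if_neg (by omega), add_zero]
  · rw [if_neg h, if_pos (by omega), zero_add]

theorem Hn_tl_le (hX : ∀ n, X n ≤ SS n) (hm : Monotone X) (m : ℕ) (s : Sq) :
    Hn X (tl m s) ≤ 2 * Hn X s := by
  rcases m with _ | L
  · rw [tl_zero]; linarith [apply_nonneg (Hn X) s]
  · have e : tl (L+1) s = s - cut L s := by rw [eq_sub_iff_add_eq, add_comm, tl_succ]
    rw [e]
    have := map_sub_le_add (Hn X) s (cut L s)
    have := Hn_cut_le hX hm L (fun _ _ => le_rfl) s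
    linarith

/-- distance functional -/
def Qd (X : ℕ → Submodule ℝ CantorC) (s : Sq) : ℝ :=
  ∑ n ∈ (DD s).support, Metric.infDist (DD s n) (X n)

theorem infDist_zero' (n : ℕ) : Metric.infDist (0 : CantorC) (X n) = 0 :=
  Metric.infDist_zero_of_mem (X n).zero_mem

theorem Qd_eq {s : Sq} {M : ℕ} (h : ∀ n, M ≤ n → s n = 0) :
    Qd X s = ∑ n ∈ Finset.range M, Metric.infDist (DD s n) (X n) := by
  refine Finset.sum_subset (supp_sub_range fun n hn => ?_) fun n _ hn => ?_
  · simp [h n hn, h (n+1) (by omega)]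
  · rw [Finsupp.notMem_support_iff.1 hn, infDist_zero']

theorem Qd_nonneg (s : Sq) : 0 ≤ Qd X s := Finset.sum_nonneg fun _ _ => Metric.infDist_nonneg

theorem Qd_le_Hn (s : Sq) : Qd X s ≤ Hn X s := by
  refine le_Hf fun w hw => ?_
  obtain ⟨M, h1, h2⟩ := two_bound s w
  rw [Qd_eq h1]
  have : l1 (DD s - w) = ∑ n ∈ Finset.range M, ‖(DD s - w) n‖ :=
    l1_eq (fun n hn => by simp [h1 n hn, h2 n hn, h1 (n+1) (by omega)])
  simp only [cost]
  rw [this]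
  have h3 : ∑ n ∈ Finset.range M, Metric.infDist (DD s n) (X n) ≤
      ∑ n ∈ Finset.range M, ‖(DD s - w) n‖ := by
    refine Finset.sum_le_sum fun n _ => ?_
    have := Metric.infDist_le_dist_of_mem (x := DD s n) (hw n)
    rwa [dist_eq_norm] at this
  linarith [norm_nonneg (sm w)]

/-- tail sums -/
def TS : Sq →ₗ[ℝ] Sq := Finsupp.lsum ℝ fun n => ∑ k ∈ Finset.range (n+1), Finsupp.lsingle k

theorem TS_single (n : ℕ) (c : CantorC) (m : ℕ) :
    TS (Finsupp.single n c) m = if m ≤ n then c else 0 := by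
  simp only [TS, Finsupp.lsum_single, LinearMap.sum_apply, Finsupp.lsingle_apply,
    Finsupp.finsetSum_apply, Finsupp.single_apply]
  simp

theorem DD_TS (ξ : Sq) (n : ℕ) : DD (TS ξ) n = rr n (ξ n) := by
  induction ξ using Finsupp.induction_linear with
  | zero => simp
  | add f g hf hg => simp only [map_add, Finsupp.add_apply, hf, hg]
  | single m c =>
    rw [DD_apply, TS_single, TS_single, Finsupp.single_apply]
    rcases lt_trichotomy m n with h | h | h
    · rw [if_neg (by omega), if_neg (by omega), if_neg (by omega), sub_zero]
    · rw [if_pos (by omega), if_neg (by omega), if_pos h, sub_zero]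
    · rw [if_pos (by omega), if_pos (by omega), if_neg (by omega), sub_self]

theorem DD_TS_of_mem (hX : ∀ n, X n ≤ SS n) {ξ : Sq} (h : ξ ∈ WW X) : DD (TS ξ) = ξ := by
  ext1 n; rw [DD_TS]; exact mem_SS.1 (hX n (h n))

theorem Hn_TS (hX : ∀ n, X n ≤ SS n) {ξ : Sq} (h : ξ ∈ WW X) : Hn X (TS ξ) = ‖sm ξ‖ := by
  have e := DD_TS_of_mem hX h
  rw [Hn_of_mem _ (by rw [e]; exact h), e]

theorem exists_approx (hX : ∀ n, X n ≤ SS n) (s : Sq) {ε : ℝ} (h : Qd X s < ε) :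
    ∃ ξ ∈ WW X, Hn X (s - TS ξ) < ε := by
  obtain ⟨M, hM⟩ := sq_bound s
  set e := (ε - Qd X s) / (M + 1) with he
  have hpos : 0 < e := by apply div_pos <;> [linarith; positivity]
  have : ∀ n, ∃ x ∈ X n, ‖DD s n - x‖ < Metric.infDist (DD s n) (X n) + e := by
    intro n
    obtain ⟨x, hx, hd⟩ := (Metric.infDist_lt_iff ⟨0, (X n).zero_mem⟩).1
      (show Metric.infDist (DD s n) (X n) < Metric.infDist (DD s n) (X n) + e by linarith)
    exact ⟨x, hx, by rwa [dist_eq_norm] at hd⟩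
  choose x hx hd using this
  let ξ : Sq := mkF (fun n => if n < M then x n else 0) ⟨M, fun n hn => by rw [if_neg (by omega)]⟩
  have hξ : ξ ∈ WW X := by
    intro n; simp only [ξ, mkF_apply]; split_ifs <;> [exact hx n; exact zero_mem _]
  refine ⟨ξ, hξ, (Hn_le_l1 _).trans_lt ?_⟩
  rw [map_sub, DD_TS_of_mem hX hξ, l1_eq (M := M) (fun n hn => by
    simp [ξ, hM n hn, hM (n+1) (by omega), not_lt.2 hn])]
  have h1 : ∑ n ∈ Finset.range M, ‖(DD s - ξ) n‖ ≤
      ∑ n ∈ Finset.range M, (Metric.infDist (DD s n) (X n) + e) := by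
    refine Finset.sum_le_sum fun n hn => ?_
    have : ξ n = x n := by simp [ξ, Finset.mem_range.1 hn]
    rw [Finsupp.sub_apply, this]; exact (hd n).le
  refine h1.trans_lt ?_
  rw [Finset.sum_add_distrib, ← Qd_eq hM]
  simp only [Finset.sum_const, Finset.card_range, nsmul_eq_mul]
  have : (M : ℝ) * e < (M + 1) * e := by nlinarith
  rw [he, mul_div_cancel₀ _ (by positivity)] at this
  linarith

/-- if the second sequence starts well after the first one, `Qd` adds up -/
theorem Qd_add (s t : Sq) (M : ℕ) (hs : ∀ n, M ≤ n → s n = 0) (ht : ∀ n, n ≤ M → rr n (t n) = 0) :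
    Qd X (s + t) = Qd X s + Qd X t := by
  obtain ⟨M', hM'⟩ := sq_bound t
  set L := max M M'
  have hsL : ∀ n, L ≤ n → s n = 0 := fun n hn => hs n (by omega)
  have htL : ∀ n, L ≤ n → t n = 0 := fun n hn => hM' n (by omega)
  rw [Qd_eq hsL, Qd_eq htL, Qd_eq (s := s + t) (M := L) (fun n hn => by simp [hsL n hn, htL n hn]),
    ← Finset.sum_add_distrib]
  refine Finset.sum_congr rfl fun n _ => ?_
  rw [map_add, Finsupp.add_apply]
  by_cases h : n < M
  · have : DD t n = 0 := by
      have e : rr n (t (n+1)) = rr n (rr (n+1) (t (n+1))) := by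
        rw [rr_rr, min_eq_left (Nat.le_succ n)]
      rw [DD_apply, map_sub, ht n h.le, e, ht (n+1) h, map_zero, sub_zero]
    rw [this, add_zero, infDist_zero', add_zero]
  · have : DD s n = 0 := by simp [hs n (by omega), hs (n+1) (by omega)]
    rw [this, zero_add, infDist_zero', zero_add]

theorem Qd_smul_ge (c : ℝ) (s : Sq) : Qd X (c • s) ≤ |c| * Qd X s := by
  rcases eq_or_ne c 0 with rfl | hc
  · simp [Qd]
  have hc' : 0 < |c| := abs_pos.2 hc
  obtain ⟨M, h1⟩ := sq_bound s
  rw [Qd_eq h1, Qd_eq (s := c • s) (M := M) (fun n hn => by simp [h1 n hn]), Finset.mul_sum]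
  refine Finset.sum_le_sum fun n _ => ?_
  rw [map_smul, Finsupp.smul_apply, ← div_le_iff₀' hc']
  refine (Metric.le_infDist ⟨0, (X n).zero_mem⟩).2 fun y hy => ?_
  rw [div_le_iff₀' hc']
  have := Metric.infDist_le_dist_of_mem (x := c • DD s n) ((X n).smul_mem c hy)
  rwa [dist_eq_norm, ← smul_sub, norm_smul, Real.norm_eq_abs, ← dist_eq_norm] at this

end
end BB

namespace BB
noncomputable section

structure TD (Λ : Type) where
  K : Set (ℕ → Λ)
  X : (ℕ → Λ) → ℕ → Submodule ℝ CantorC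
  hX : ∀ σ n, X σ n ≤ SS n
  mono : ∀ σ, Monotone (X σ)
  loc : ∀ σ τ n, (∀ l < n, σ l = τ l) → X σ n = X τ n

variable {Λ : Type}

def nd (σ : ℕ → Λ) (n : ℕ) : List Λ := (List.range n).map σ

theorem nd_length (σ : ℕ → Λ) (n : ℕ) : (nd σ n).length = n := by simp [nd]

theorem nd_eq {σ τ : ℕ → Λ} {n m : ℕ} : nd σ n = nd τ m ↔ n = m ∧ ∀ l < n, σ l = τ l := by
  constructor
  · intro h
    have h1 : n = m := by rw [← nd_length σ n, h, nd_length]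
    subst h1
    exact ⟨rfl, fun l hl => List.map_inj_left.1 h l (List.mem_range.2 hl)⟩
  · rintro ⟨rfl, h⟩
    exact List.map_inj_left.2 fun l hl => h l (List.mem_range.1 hl)

theorem nd_inj (σ : ℕ → Λ) : Function.Injective (nd σ) := fun _ _ h => (nd_eq.1 h).1

/-- coordinates along a branch -/
def crd (σ : ℕ → Λ) : (List Λ →₀ CantorC) →ₗ[ℝ] Sq := Finsupp.lcomapDomain (nd σ) (nd_inj σ)

theorem crd_apply (σ : ℕ → Λ) (z : List Λ →₀ CantorC) (n : ℕ) : crd σ z n = z (nd σ n) := rfl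

def NN (D : TD Λ) (p : (ℕ → Λ) × ℕ) : Seminorm ℝ (List Λ →₀ CantorC) :=
  (Hn (D.X p.1)).comp ((tl p.2).comp (crd p.1))

theorem NN_apply (D : TD Λ) (p : (ℕ → Λ) × ℕ) (z : List Λ →₀ CantorC) :
    NN D p z = Hn (D.X p.1) (tl p.2 (crd p.1 z)) := rfl

theorem NN_zero (D : TD Λ) (σ : ℕ → Λ) (z : List Λ →₀ CantorC) :
    NN D (σ, 0) z = Hn (D.X σ) (crd σ z) := by rw [NN_apply, tl_zero]

theorem NN_le_two (D : TD Λ) (σ : ℕ → Λ) (n : ℕ) (z : List Λ →₀ CantorC) :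
    NN D (σ, n) z ≤ 2 * NN D (σ, 0) z := by
  rw [NN_zero]; exact Hn_tl_le (D.hX σ) (D.mono σ) n _

def Incomp (p q : (ℕ → Λ) × ℕ) : Prop := ∃ l, l < p.2 ∧ l < q.2 ∧ p.1 l ≠ q.1 l

theorem Incomp.symm {p q : (ℕ → Λ) × ℕ} (h : Incomp p q) : Incomp q p := by
  obtain ⟨l, h1, h2, h3⟩ := h
  exact ⟨l, h2, h1, h3.symm⟩

def IsFam (D : TD Λ) (I : Finset ((ℕ → Λ) × ℕ)) : Prop :=
  (∀ p ∈ I, p.1 ∈ D.K) ∧ (I : Set ((ℕ → Λ) × ℕ)).Pairwise Incomp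

def sqs (D : TD Λ) (I : Finset ((ℕ → Λ) × ℕ)) (z : List Λ →₀ CantorC) : ℝ :=
  ∑ p ∈ I, (NN D p z) ^ 2

theorem sqs_nonneg (D : TD Λ) (I : Finset ((ℕ → Λ) × ℕ)) (z : List Λ →₀ CantorC) :
    0 ≤ sqs D I z := Finset.sum_nonneg fun _ _ => sq_nonneg _

theorem NN_ne_zero {D : TD Λ} {p : (ℕ → Λ) × ℕ} {z : List Λ →₀ CantorC} (h : NN D p z ≠ 0) :
    ∃ n, p.2 ≤ n ∧ z (nd p.1 n) ≠ 0 := by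
  by_contra hc
  push Not at hc
  apply h
  have : tl p.2 (crd p.1 z) = 0 := by
    ext1 n
    rw [tl_apply, crd_apply]
    split_ifs with hn
    · exact hc n hn
    · rfl
  rw [NN_apply, this, map_zero]

open Classical in
theorem card_meet {D : TD Λ} {I : Finset ((ℕ → Λ) × ℕ)} (hI : IsFam D I) (S : Finset (List Λ)) :
    (I.filter fun p => ∃ n, p.2 ≤ n ∧ nd p.1 n ∈ S).card ≤ S.card := by
  have : ∀ p ∈ I.filter fun p => ∃ n, p.2 ≤ n ∧ nd p.1 n ∈ S,
      ∃ n, p.2 ≤ n ∧ nd p.1 n ∈ S := fun p hp => (Finset.mem_filter.1 hp).2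
  choose! n h1 h2 using this
  refine Finset.card_le_card_of_injOn (fun p => nd p.1 (n p)) (fun p hp => h2 p hp) ?_
  intro p hp q hq heq
  by_contra hne
  obtain ⟨l, hl1, hl2, hl3⟩ := hI.2 (Finset.mem_filter.1 hp).1 (Finset.mem_filter.1 hq).1 hne
  exact hl3 ((nd_eq.1 heq).2 l (hl1.trans_le (h1 p hp)))

open Classical in
theorem sqs_le_card {D : TD Λ} (I : Finset ((ℕ → Λ) × ℕ)) (z : List Λ →₀ CantorC) {B : ℝ} (k : ℕ)
    (hB : ∀ p ∈ I, NN D p z ≤ B) (hk : (I.filter fun p => NN D p z ≠ 0).card ≤ k) :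
    sqs D I z ≤ k * B ^ 2 := by
  have h1 : sqs D I z = ∑ p ∈ I.filter (fun p => NN D p z ≠ 0), (NN D p z) ^ 2 := by
    rw [sqs, Finset.sum_filter]
    refine Finset.sum_congr rfl fun p _ => ?_
    split_ifs with h
    · rfl
    · rw [not_not.1 h]; norm_num
  rw [h1]
  have h2 : ∑ p ∈ I.filter (fun p => NN D p z ≠ 0), (NN D p z) ^ 2 ≤
      ∑ p ∈ I.filter (fun p => NN D p z ≠ 0), B ^ 2 := by
    refine Finset.sum_le_sum fun p hp => ?_
    exact pow_le_pow_left₀ (apply_nonneg _ _) (hB p (Finset.mem_filter.1 hp).1) 2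
  refine h2.trans ?_
  rw [Finset.sum_const, nsmul_eq_mul]
  gcongr

theorem l1_DD_le (s : Sq) : l1 (DD s) ≤ 2 * l1 s := by
  obtain ⟨M, hM⟩ := sq_bound s
  rw [l1_eq (s := DD s) (M := M) (fun n hn => by simp [hM n hn, hM (n+1) (by omega)])]
  have h1 : ∑ n ∈ Finset.range M, ‖DD s n‖ ≤
      ∑ n ∈ Finset.range M, ‖s n‖ + ∑ n ∈ Finset.range M, ‖s (n+1)‖ := by
    rw [← Finset.sum_add_distrib]
    exact Finset.sum_le_sum fun n _ => (norm_rr_le _ _).trans (norm_sub_le _ _)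
  have h2 : ∑ n ∈ Finset.range M, ‖s (n+1)‖ ≤ l1 s := by
    rw [l1_eq (M := M+1) (fun n hn => hM n (by omega)), Finset.sum_range_succ']
    linarith [norm_nonneg (s 0)]
  rw [← l1_eq hM] at h1
  linarith

theorem NN_le_sum (D : TD Λ) (p : (ℕ → Λ) × ℕ) (z : List Λ →₀ CantorC) :
    NN D p z ≤ 2 * ∑ t ∈ z.support, ‖z t‖ := by
  classical
  rw [NN_apply]
  refine (Hn_le_l1 _).trans ((l1_DD_le _).trans ?_)
  refine mul_le_mul_of_nonneg_left ?_ (by norm_num)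
  have h : ∀ n ∈ (tl p.2 (crd p.1 z)).support, ‖(tl p.2 (crd p.1 z)) n‖ = ‖z (nd p.1 n)‖ ∧
      z (nd p.1 n) ≠ 0 := by
    intro n hn
    have := Finsupp.mem_support_iff.1 hn
    rw [tl_apply, crd_apply] at *
    split_ifs at * with h
    · exact ⟨rfl, this⟩
    · exact absurd rfl this
  rw [l1, Finset.sum_congr rfl (fun n hn => (h n hn).1),
    ← Finset.sum_image (f := fun t => ‖z t‖) (fun a _ b _ hab => nd_inj p.1 hab)]
  refine Finset.sum_le_sum_of_subset_of_nonneg ?_ fun _ _ _ => norm_nonneg _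
  intro t ht
  obtain ⟨n, hn, rfl⟩ := Finset.mem_image.1 ht
  exact Finsupp.mem_support_iff.2 (h n hn).2

theorem sqs_bdd {D : TD Λ} {I : Finset ((ℕ → Λ) × ℕ)} (hI : IsFam D I) (z : List Λ →₀ CantorC) :
    sqs D I z ≤ z.support.card * (2 * ∑ t ∈ z.support, ‖z t‖) ^ 2 := by
  classical
  refine sqs_le_card I z _ (fun p _ => NN_le_sum D p z) ?_
  refine le_trans (Finset.card_le_card ?_) (card_meet hI z.support)
  intro p hp
  rw [Finset.mem_filter] at *
  obtain ⟨n, h1, h2⟩ := NN_ne_zero hp.2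
  exact ⟨hp.1, n, h1, Finsupp.mem_support_iff.2 h2⟩

theorem isFam_empty (D : TD Λ) : IsFam D ∅ := ⟨by simp, by simp⟩

def nf (D : TD Λ) (z : List Λ →₀ CantorC) : ℝ :=
  ⨆ I : {I : Finset ((ℕ → Λ) × ℕ) // IsFam D I}, √(sqs D I.1 z)

theorem nf_bdd (D : TD Λ) (z : List Λ →₀ CantorC) :
    BddAbove (Set.range fun I : {I : Finset ((ℕ → Λ) × ℕ) // IsFam D I} => √(sqs D I.1 z)) := by
  refine ⟨√(z.support.card * (2 * ∑ t ∈ z.support, ‖z t‖) ^ 2), ?_⟩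
  rintro _ ⟨I, rfl⟩
  exact Real.sqrt_le_sqrt (sqs_bdd I.2 z)

theorem le_nf (D : TD Λ) (z : List Λ →₀ CantorC) {I : Finset ((ℕ → Λ) × ℕ)} (hI : IsFam D I) :
    √(sqs D I z) ≤ nf D z := le_ciSup (nf_bdd D z) (⟨I, hI⟩ : {I // IsFam D I})

theorem nf_le (D : TD Λ) (z : List Λ →₀ CantorC) {B : ℝ}
    (h : ∀ I, IsFam D I → √(sqs D I z) ≤ B) : nf D z ≤ B :=
  haveI : Nonempty {I : Finset ((ℕ → Λ) × ℕ) // IsFam D I} := ⟨⟨∅, isFam_empty D⟩⟩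
  ciSup_le fun I => h I.1 I.2

theorem sqrt_tri {ι : Type*} (I : Finset ι) (f g h : ι → ℝ) (h0 : ∀ i, 0 ≤ h i)
    (hh : ∀ i, h i ≤ f i + g i) :
    √(∑ i ∈ I, h i ^ 2) ≤ √(∑ i ∈ I, f i ^ 2) + √(∑ i ∈ I, g i ^ 2) := by
  rw [Real.sqrt_le_left (by positivity), add_sq,
    Real.sq_sqrt (Finset.sum_nonneg fun _ _ => sq_nonneg _),
    Real.sq_sqrt (Finset.sum_nonneg fun _ _ => sq_nonneg _)]
  have h1 : ∑ i ∈ I, h i ^ 2 ≤ ∑ i ∈ I, (f i ^ 2 + 2 * (f i * g i) + g i ^ 2) := by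
    refine Finset.sum_le_sum fun i _ => ?_
    have := pow_le_pow_left₀ (h0 i) (hh i) 2
    linarith [add_sq (f i) (g i)]
  rw [Finset.sum_add_distrib, Finset.sum_add_distrib, ← Finset.mul_sum] at h1
  have h2 := Real.sum_mul_le_sqrt_mul_sqrt I f g
  linarith

theorem nf_nonneg (D : TD Λ) (z : List Λ →₀ CantorC) : 0 ≤ nf D z :=
  (Real.sqrt_nonneg _).trans (le_nf D z (isFam_empty D))

def nV (D : TD Λ) : Seminorm ℝ (List Λ →₀ CantorC) :=
  Seminorm.ofSMulLE (nf D)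
    (le_antisymm (nf_le D 0 fun I _ => by simp [sqs]) (nf_nonneg D 0))
    (by
      intro y z
      refine nf_le D _ fun I hI => ?_
      refine (sqrt_tri I (fun p => NN D p y) (fun p => NN D p z) (fun p => NN D p (y + z))
        (fun p => apply_nonneg _ _) (fun p => map_add_le_add _ _ _)).trans ?_
      exact add_le_add (le_nf D y hI) (le_nf D z hI))
    (by
      intro c z
      refine nf_le D _ fun I hI => ?_
      have : sqs D I (c • z) = ‖c‖ ^ 2 * sqs D I z := by
        simp only [sqs, Finset.mul_sum, map_smul_eq_mul, mul_pow]
      rw [this, Real.sqrt_mul (sq_nonneg _), Real.sqrt_sq (norm_nonneg _)]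
      exact mul_le_mul_of_nonneg_left (le_nf D z hI) (norm_nonneg _))

theorem nV_apply (D : TD Λ) (z : List Λ →₀ CantorC) : nV D z = nf D z := rfl

theorem sqs_le (D : TD Λ) (z : List Λ →₀ CantorC) {I : Finset ((ℕ → Λ) × ℕ)} (hI : IsFam D I) :
    sqs D I z ≤ nV D z ^ 2 := by
  have := le_nf D z hI
  rwa [Real.sqrt_le_left (nf_nonneg D z)] at this

theorem nV_sq_le (D : TD Λ) (z : List Λ →₀ CantorC) {B : ℝ} (hB : 0 ≤ B)
    (h : ∀ I, IsFam D I → sqs D I z ≤ B) : nV D z ^ 2 ≤ B := by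
  have : nV D z ≤ √B := nf_le D z fun I hI => Real.sqrt_le_sqrt (h I hI)
  have h2 := pow_le_pow_left₀ (apply_nonneg _ _) this 2
  rwa [Real.sq_sqrt hB] at h2

theorem isFam_singleton (D : TD Λ) {p : (ℕ → Λ) × ℕ} (hp : p.1 ∈ D.K) : IsFam D {p} :=
  ⟨by simpa using hp, by simp⟩

theorem NN_le_nV (D : TD Λ) {p : (ℕ → Λ) × ℕ} (hp : p.1 ∈ D.K) (z : List Λ →₀ CantorC) :
    NN D p z ≤ nV D z := by
  have := sqs_le D z (isFam_singleton D hp)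
  rw [sqs, Finset.sum_singleton] at this
  exact le_of_sq_le_sq this (apply_nonneg _ _)

/-! ### branches embed -/
def kap (σ : ℕ → Λ) : Sq →ₗ[ℝ] (List Λ →₀ CantorC) := (Finsupp.lmapDomain CantorC ℝ (nd σ)) ∘ₗ TS

theorem kap_apply (σ : ℕ → Λ) (ξ : Sq) : kap σ ξ = Finsupp.mapDomain (nd σ) (TS ξ) := rfl

theorem crd_kap (σ : ℕ → Λ) (ξ : Sq) : crd σ (kap σ ξ) = TS ξ := by
  ext1 n
  rw [crd_apply, kap_apply, Finsupp.mapDomain_apply (nd_inj σ)]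

theorem NN_kap (D : TD Λ) (σ : ℕ → Λ) {ξ : Sq} (h : ξ ∈ WW (D.X σ)) :
    NN D (σ, 0) (kap σ ξ) = ‖sm ξ‖ := by
  rw [NN_zero, crd_kap, Hn_TS (D.hX σ) h]

theorem NN_kap_le (D : TD Λ) (σ : ℕ → Λ) {ξ : Sq} (h : ξ ∈ WW (D.X σ)) (p : (ℕ → Λ) × ℕ) :
    NN D p (kap σ ξ) ≤ 2 * ‖sm ξ‖ := by
  classical
  obtain ⟨τ, m⟩ := p
  refine (NN_le_two D τ m _).trans ?_
  refine mul_le_mul_of_nonneg_left ?_ (by norm_num)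
  rw [NN_zero]
  by_cases hst : ∀ l, τ l = σ l
  · obtain rfl : τ = σ := funext hst
    rw [crd_kap, Hn_TS (D.hX τ) h]
  · push Not at hst
    have hL := Nat.find_spec hst
    have hmin : ∀ l < Nat.find hst, τ l = σ l := fun l hl => not_not.1 (Nat.find_min hst hl)
    set L := Nat.find hst
    have e : crd τ (kap σ ξ) = cut L (TS ξ) := by
      ext1 n
      rw [crd_apply, cut_apply, kap_apply]
      split_ifs with hn
      · have : nd τ n = nd σ n := nd_eq.2 ⟨rfl, fun l hl => hmin l (by omega)⟩
        rw [this, Finsupp.mapDomain_apply (nd_inj σ)]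
      · refine Finsupp.mapDomain_of_notMem_range _ _ ?_
        rintro ⟨k, hk⟩
        obtain ⟨rfl, h2⟩ := nd_eq.1 hk
        exact hL (h2 L (by omega)).symm
    rw [e, ← Hn_TS (D.hX σ) h]
    exact Hn_cut_le (D.hX σ) (D.mono τ) L
      (fun k hk => (D.loc σ τ k fun l hl => (hmin l (by omega)).symm).le) _

theorem le_nV_kap (D : TD Λ) {σ : ℕ → Λ} (hσ : σ ∈ D.K) {ξ : Sq} (h : ξ ∈ WW (D.X σ)) :
    ‖sm ξ‖ ≤ nV D (kap σ ξ) := by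
  rw [← NN_kap D σ h]; exact NN_le_nV D (p := (σ, 0)) hσ _

theorem nV_kap_le (D : TD Λ) (σ : ℕ → Λ) {ξ : Sq} (h : ξ ∈ WW (D.X σ)) :
    nV D (kap σ ξ) ≤ 2 * ‖sm ξ‖ := by
  classical
  refine le_of_sq_le_sq ?_ (by positivity)
  refine nV_sq_le D _ (by positivity) fun I hI => ?_
  have := sqs_le_card I (kap σ ξ) 1 (fun p _ => NN_kap_le D σ h p) (by
    rw [Finset.card_le_one]
    intro p hp q hq
    rw [Finset.mem_filter] at hp hq
    by_contra hne
    obtain ⟨l, h1, h2, h3⟩ := hI.2 hp.1 hq.1 hne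
    have key : ∀ p : (ℕ → Λ) × ℕ, NN D p (kap σ ξ) ≠ 0 → ∀ l < p.2, p.1 l = σ l := by
      intro p hp l hl
      obtain ⟨n, hn, hz⟩ := NN_ne_zero hp
      by_contra hc
      apply hz
      rw [kap_apply]
      refine Finsupp.mapDomain_of_notMem_range _ _ ?_
      rintro ⟨k, hk⟩
      obtain ⟨rfl, h2⟩ := nd_eq.1 hk
      exact hc (h2 l (by omega)).symm
    exact h3 ((key p hp.2 l h1).trans (key q hq.2 l h2).symm))
  simpa using this

end
end BB

namespace BB
noncomputable section

/-- normalised functions supported in `U` -/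
def Nz (U : Set CantorSet) (g : LL) : Prop :=
  Sup U g ∧ (∀ x, |(g : CantorC) x| ≤ 1) ∧ ∃ x, (g : CantorC) x = 1

theorem Nz.norm_le {U : Set CantorSet} {g : LL} (h : Nz U g) : ‖g‖ ≤ 1 :=
  LL_norm_le g zero_le_one h.2.1

theorem exists_Nz {U : Set CantorSet} {f : LL} (hf : f ≠ 0) (h : Sup U f) :
    ∃ c : ℝ, |c| = ‖f‖⁻¹ ∧ Nz U (c • f) := by
  obtain ⟨c, h1, h2, h3⟩ := exists_normalise f hf
  exact ⟨c, h1, h.smul c, h2, h3⟩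

theorem lemmaA' (Pr : ℕ → LL → Prop)
    (hPr : ∀ k U, IsOpen U → U.Nonempty → ∃ g : LL, Nz U g ∧ Pr k g)
    {U0 : Set CantorSet} (hU0 : IsOpen U0) (hne : U0.Nonempty) :
    ∃ g : ℕ → LL, (∀ k, Pr k (g k)) ∧ ∀ f, ‖f‖ ≤ ‖Phi g f‖ ∧ ‖Phi g f‖ ≤ 3 * ‖f‖ ∧
      Sup U0 (Phi g f) := by
  refine lemmaA Pr (fun k U h1 h2 => ?_) hU0 hne
  obtain ⟨g, ⟨h3, h4, h5⟩, h6⟩ := hPr k U h1 h2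
  exact ⟨g, h3, h4, h5, h6⟩

theorem norm_disj {A B : Set CantorSet} {f g : LL} (hA : Sup A f) (hB : Sup B g)
    (hd : Disjoint A B) (hf : ‖f‖ ≤ 1) (hg : ‖g‖ ≤ 1) : ‖f + g‖ ≤ 1 := by
  refine LL_norm_le _ zero_le_one fun x => ?_
  simp only [Submodule.coe_add, ContinuousMap.add_apply]
  by_cases hx : x ∈ A
  · rw [hB x (fun h => Set.disjoint_left.1 hd hx h), add_zero]
    exact (LL_abs_le f x).trans hf
  · rw [hA x hx, zero_add]
    exact (LL_abs_le g x).trans hg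

/-- finitely many functionals can be killed -/
theorem exists_killed {ι : Type*} [DecidableEq ι] (φ : ι → LL →ₗ[ℝ] ℝ) (S : Finset ι) :
    ∀ W : Set CantorSet, IsOpen W → W.Nonempty → ∃ f : LL, f ≠ 0 ∧ Sup W f ∧ ∀ i ∈ S, φ i f = 0 := by
  induction S using Finset.induction_on with
  | empty =>
    intro W hW hne
    obtain ⟨g, h1, -, x, hx⟩ := exists_bump hW hne
    refine ⟨g, ?_, h1, by simp⟩
    rintro rfl
    simp at hx
  | insert i S _ ih =>
    intro W hW hne
    obtain ⟨V1, V2, o1, o2, n1, n2, s1, s2, hd⟩ := split_open hW hne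
    obtain ⟨f1, a1, b1, c1⟩ := ih V1 o1 n1
    obtain ⟨f2, a2, b2, c2⟩ := ih V2 o2 n2
    by_cases h : φ i f1 = 0
    · refine ⟨f1, a1, b1.mono s1, fun j hj => ?_⟩
      rcases Finset.mem_insert.1 hj with rfl | hj
      · exact h
      · exact c1 j hj
    · refine ⟨φ i f2 • f1 + (-φ i f1) • f2, ?_,
        ((b1.mono s1).smul _).add ((b2.mono s2).smul _), fun j hj => ?_⟩
      · intro h0
        obtain ⟨x, hx⟩ := exists_norm_attain f2
        have hpos : 0 < ‖f2‖ := norm_pos_iff.2 a2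
        have hx2 : (f2 : CantorC) x ≠ 0 := by
          intro h'; rw [h', abs_zero] at hx; exact hpos.ne hx
        have hxV : x ∈ V2 := by by_contra h'; exact hx2 (b2 x h')
        have h3 : (((φ i f2 • f1 + (-φ i f1) • f2 : LL)) : CantorC) x = 0 := by rw [h0]; rfl
        simp [b1 x (fun h' => Set.disjoint_left.1 hd h' hxV), h, hx2] at h3
      · rcases Finset.mem_insert.1 hj with rfl | hj
        · simp; ring
        · simp [c1 j hj, c2 j hj]

theorem SS_eq_zero {n : ℕ} {f : CantorC} (hf : f ∈ SS n) (h : ∀ k < 2 ^ n, f (qq k) = 0) :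
    f = 0 := by
  ext x
  have : f x = f (qq (Nat.ofBits (fun i : Fin n => x i))) := by
    refine SS_apply hf fun i hi => ?_
    simp only [qq]
    rw [Nat.testBit_ofBits_lt _ _ hi]
  rw [this]
  exact h _ (Nat.ofBits_lt_two_pow _)

variable {Λ : Type}

def evalL (x : CantorSet) : CantorC →ₗ[ℝ] ℝ where
  toFun f := f x
  map_add' _ _ := rfl
  map_smul' _ _ := rfl

theorem exists_late (E : LL →ₗ[ℝ] (List Λ →₀ CantorC)) (σ : ℕ → Λ) (m : ℕ)
    {W : Set CantorSet} (hW : IsOpen W) (hne : W.Nonempty) :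
    ∃ f : LL, f ≠ 0 ∧ Sup W f ∧ ∀ n ≤ m, rr n (crd σ (E f) n) = 0 := by
  classical
  obtain ⟨f, h1, h2, h3⟩ := exists_killed
    (fun p : ℕ × ℕ => (evalL (qq p.2)) ∘ₗ (rr p.1) ∘ₗ (Finsupp.lapply p.1) ∘ₗ (crd σ) ∘ₗ E)
    (Finset.range (m+1) ×ˢ Finset.range (2 ^ m)) W hW hne
  refine ⟨f, h1, h2, fun n hn => SS_eq_zero (rr_mem_SS n _) fun k hk => ?_⟩
  refine h3 (n, k) ?_
  rw [Finset.mem_product, Finset.mem_range, Finset.mem_range]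
  exact ⟨by omega, hk.trans_le (Nat.pow_le_pow_right (by norm_num) hn)⟩

variable {D : TD Λ} {E : LL →ₗ[ℝ] (List Λ →₀ CantorC)} {M : ℝ}

theorem Qnull (hE : ∀ f, nV D (E f) ≤ M * ‖f‖) {σ : ℕ → Λ} (hσ : σ ∈ D.K)
    {U : Set CantorSet} (hU : IsOpen U) (hne : U.Nonempty) {ε : ℝ} (hε : 0 < ε) :
    ∃ g, Nz U g ∧ Qd (D.X σ) (crd σ (E g)) < ε := by
  by_contra hcon
  push Not at hcon
  have key : ∀ k : ℕ, ∀ U' ⊆ U, IsOpen U' → U'.Nonempty → ∃ F : LL, Sup U' F ∧ ‖F‖ ≤ 1 ∧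
      k * ε ≤ Qd (D.X σ) (crd σ (E F)) := by
    intro k
    induction k with
    | zero => intro U' _ _ _; exact ⟨0, fun x _ => rfl, by simp, by simp [Qd_nonneg]⟩
    | succ k ih =>
      intro U' hsub ho hn
      obtain ⟨V, W, o1, o2, n1, n2, s1, s2, hd⟩ := split_open ho hn
      obtain ⟨F, hF1, hF2, hF3⟩ := ih V (s1.trans hsub) o1 n1
      obtain ⟨m, hm⟩ := sq_bound (crd σ (E F))
      obtain ⟨f, hf0, hf1, hf2⟩ := exists_late E σ m o2 n2
      obtain ⟨c, -, hN⟩ := exists_Nz hf0 hf1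
      refine ⟨F + c • f, (hF1.mono s1).add ((hf1.mono s2).smul c),
        norm_disj hF1 hN.1 hd hF2 hN.norm_le, ?_⟩
      rw [map_add, map_add, Qd_add _ _ m hm (fun n hn => by
        rw [map_smul, map_smul, Finsupp.smul_apply, map_smul, hf2 n hn, smul_zero])]
      have := hcon (c • f) ⟨hN.1.mono (s2.trans hsub), hN.2⟩
      push_cast
      linarith
  obtain ⟨k, hk⟩ := exists_nat_gt (|M| / ε)
  obtain ⟨F, -, h2, h3⟩ := key k U le_rfl hU hne
  have h4 : Qd (D.X σ) (crd σ (E F)) ≤ |M| := by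
    refine (Qd_le_Hn _).trans ?_
    rw [← NN_zero]
    refine (NN_le_nV D (p := (σ, 0)) hσ _).trans ((hE F).trans ?_)
    calc M * ‖F‖ ≤ |M| * 1 := by gcongr; exact le_abs_self M
      _ = |M| := mul_one _
  rw [div_lt_iff₀ hε] at hk
  linarith

theorem L1 (hnu : ∀ σ ∈ D.K, ¬ Embeds CantorC (⨆ n, D.X σ n).topologicalClosure)
    (hE : ∀ f, nV D (E f) ≤ M * ‖f‖) {σ : ℕ → Λ} (hσ : σ ∈ D.K) {c : ℝ} (hc : 0 < c) :
    ∃ f, f ≠ 0 ∧ NN D (σ, 0) (E f) < c * ‖f‖ := by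
  by_contra hcon
  push Not at hcon
  have hlow : ∀ f, c * ‖f‖ ≤ NN D (σ, 0) (E f) := by
    intro f
    by_cases hf : f = 0
    · simp [hf]
    · exact hcon f hf
  obtain ⟨g, hg1, hg2⟩ := lemmaA' (fun k g => Qd (D.X σ) (crd σ (E g)) < (c/2)/4*(1/2)^k)
    (fun k U h1 h2 => Qnull hE hσ h1 h2 (by positivity)) isOpen_univ Set.univ_nonempty
  choose ξ hξ1 hξ2 using fun k => exists_approx (D.hX σ) _ (hg1 k)
  have hmem : ∀ f, Phi ξ f ∈ WW (D.X σ) := by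
    intro f
    rw [Phi_apply]
    exact Submodule.sum_mem _ fun k _ => Submodule.smul_mem _ _ (hξ1 k)
  have hclose : ∀ f, Hn (D.X σ) (crd σ (E (Phi g f)) - TS (Phi ξ f)) ≤ c/2 * ‖f‖ := by
    intro f
    have e : crd σ (E (Phi g f)) - TS (Phi ξ f) =
        Phi (fun k => crd σ (E (g k)) - TS (ξ k)) f := by
      rw [← Phi_sub, map_Phi, map_Phi, map_Phi]
    rw [e]
    exact Phi_small _ _ (fun k => (hξ2 k).le) (by positivity) f
  have hmem2 : ∀ f, (sm ∘ₗ Phi ξ) f ∈ (⨆ n, D.X σ n).topologicalClosure := by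
    intro f
    refine Submodule.le_topologicalClosure _ ?_
    obtain ⟨m, hm⟩ := sq_bound (Phi ξ f)
    simp only [LinearMap.comp_apply]
    rw [sm_eq hm]
    exact Submodule.sum_mem _ fun n _ => Submodule.mem_iSup_of_mem n (hmem f n)
  refine hnu σ hσ ?_
  haveI : CompleteSpace (⨆ n, D.X σ n).topologicalClosure :=
    (Submodule.isClosed_topologicalClosure _).completeSpace_coe
  refine extEmb (M := LL) LL.subtype (by
      rw [DenseRange]
      have : Set.range LL.subtype = (LL : Set CantorC) := by ext x; simp
      rw [this]; exact dense_LL)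
    ((sm ∘ₗ Phi ξ).codRestrict _ hmem2) (c := c/2) (C := 3 * |M| + c/2) (by positivity) ?_ ?_
  · intro f
    change c/2 * ‖f‖ ≤ ‖sm (Phi ξ f)‖
    rw [← Hn_TS (D.hX σ) (hmem f)]
    have h1 := hlow (Phi g f)
    rw [NN_zero] at h1
    have h2 := map_sub_le_add (Hn (D.X σ)) (crd σ (E (Phi g f))) (crd σ (E (Phi g f)) - TS (Phi ξ f))
    have h3 := map_add_le_add (Hn (D.X σ)) (crd σ (E (Phi g f)) - TS (Phi ξ f)) (TS (Phi ξ f))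
    rw [sub_add_cancel] at h3
    have h4 := mul_le_mul_of_nonneg_left (hg2 f).1 hc.le
    linarith [hclose f]
  · intro f
    change ‖sm (Phi ξ f)‖ ≤ (3 * |M| + c/2) * ‖f‖
    rw [← Hn_TS (D.hX σ) (hmem f)]
    have h1 := (NN_le_nV D (p := (σ, 0)) hσ _).trans (hE (Phi g f))
    rw [NN_zero] at h1
    have h2 := map_sub_le_add (Hn (D.X σ)) (crd σ (E (Phi g f))) (crd σ (E (Phi g f)) - TS (Phi ξ f))
    rw [sub_sub_cancel] at h2
    have h4 : M * ‖Phi g f‖ ≤ |M| * (3 * ‖f‖) := by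
      gcongr
      · exact le_abs_self M
      · exact (hg2 f).2.1
    linarith [hclose f]

theorem L2 (hnu : ∀ σ ∈ D.K, ¬ Embeds CantorC (⨆ n, D.X σ n).topologicalClosure)
    (hE : ∀ f, nV D (E f) ≤ M * ‖f‖) (F : Finset (ℕ → Λ)) :
    (∀ σ ∈ F, σ ∈ D.K) → ∀ (U : Set CantorSet), IsOpen U → U.Nonempty → ∀ ε : ℝ, 0 < ε →
    ∃ g, Nz U g ∧ ∀ σ ∈ F, NN D (σ, 0) (E g) < ε := by
  classical
  induction F using Finset.induction_on with
  | empty =>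
    intro _ U hU hne ε _
    obtain ⟨g, hg⟩ := exists_bump hU hne
    exact ⟨g, hg, by simp⟩
  | insert σ F _ ih =>
    intro hF U hU hne ε hε
    have hF' : ∀ τ ∈ F, τ ∈ D.K := fun τ hτ => hF τ (Finset.mem_insert_of_mem hτ)
    obtain ⟨g, hg1, hg2⟩ := lemmaA' (fun k g => ∀ τ ∈ F, NN D (τ, 0) (E g) < (ε/2)/4*(1/2)^k)
      (fun k U h1 h2 => ih hF' U h1 h2 _ (by positivity)) hU hne
    have hsmall : ∀ τ ∈ F, ∀ f, NN D (τ, 0) (E (Phi g f)) ≤ ε/2 * ‖f‖ := by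
      intro τ hτ f
      rw [map_Phi]
      exact Phi_small _ _ (fun k => (hg1 k τ hτ).le) (by positivity) f
    obtain ⟨f, hf0, hf⟩ := L1 (E := E ∘ₗ Phi g) (M := |M| * 3) hnu (by
      intro f
      refine (hE (Phi g f)).trans ?_
      calc M * ‖Phi g f‖ ≤ |M| * (3 * ‖f‖) := by
            gcongr
            · exact le_abs_self M
            · exact (hg2 f).2.1
        _ = _ := by ring) (hF σ (Finset.mem_insert_self _ _)) (show 0 < ε/2 by positivity)
    have hpos : 0 < ‖f‖ := norm_pos_iff.2 hf0
    have hpos2 : 0 < ‖Phi g f‖ := hpos.trans_le (hg2 f).1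
    obtain ⟨c, hc, hN⟩ := exists_Nz (norm_pos_iff.1 hpos2) (hg2 f).2.2
    refine ⟨c • Phi g f, hN, ?_⟩
    have hle : ∀ τ ∈ insert σ F, NN D (τ, 0) (E (Phi g f)) ≤ ε/2 * ‖f‖ := by
      intro τ hτ
      rcases Finset.mem_insert.1 hτ with rfl | hτ
      · exact hf.le
      · exact hsmall τ hτ f
    intro τ hτ
    rw [map_smul, map_smul_eq_mul, Real.norm_eq_abs, hc, inv_mul_lt_iff₀ hpos2]
    have h1 := hle τ hτ
    have h2 := (hg2 f).1
    nlinarith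

/-- the sign trick -/
theorem sign_step {ι W : Type*} [AddCommGroup W] [Module ℝ W] (N : ι → Seminorm ℝ W)
    (N0 : Seminorm ℝ W) (S : Finset ι) (Y z : W) :
    ∃ s : ℝ, |s| = 1 ∧ ∑ i ∈ S, (N i Y) ^ 2 + (N0 z) ^ 2 ≤
      ∑ i ∈ S, (N i (Y + s • z)) ^ 2 + (N0 (Y + s • z)) ^ 2 := by
  have h1 : ∀ i, 2 * (N i Y) ^ 2 ≤ (N i (Y + z)) ^ 2 + (N i (Y - z)) ^ 2 := by
    intro i
    have h := map_add_le_add (N i) (Y + z) (Y - z)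
    have e : (Y + z) + (Y - z) = (2 : ℝ) • Y := by rw [two_smul]; abel
    rw [e, map_smul_eq_mul] at h
    norm_num at h
    nlinarith [apply_nonneg (N i) Y, apply_nonneg (N i) (Y+z), apply_nonneg (N i) (Y-z),
      sq_nonneg (N i (Y+z) - N i (Y-z))]
  have h2 : 2 * (N0 z) ^ 2 ≤ (N0 (Y + z)) ^ 2 + (N0 (Y - z)) ^ 2 := by
    have h := map_sub_le_add N0 (Y + z) (Y - z)
    have e : (Y + z) - (Y - z) = (2 : ℝ) • z := by rw [two_smul]; abel
    rw [e, map_smul_eq_mul] at h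
    norm_num at h
    nlinarith [apply_nonneg N0 z, apply_nonneg N0 (Y+z), apply_nonneg N0 (Y-z),
      sq_nonneg (N0 (Y+z) - N0 (Y-z))]
  have h3 := Finset.sum_le_sum fun i (_ : i ∈ S) => h1 i
  rw [← Finset.mul_sum, Finset.sum_add_distrib] at h3
  by_contra hcon
  push Not at hcon
  have a1 := hcon 1 (by norm_num)
  have a2 := hcon (-1) (by norm_num)
  rw [one_smul] at a1
  rw [neg_one_smul, ← sub_eq_add_neg] at a2
  linarith

end
end BB

namespace BB
noncomputable section

theorem norm_smul_LL {s : ℝ} (hs : |s| = 1) {f : LL} (hf : ‖f‖ ≤ 1) : ‖s • f‖ ≤ 1 := by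
  refine LL_norm_le _ zero_le_one fun x => ?_
  simp only [Submodule.coe_smul, ContinuousMap.smul_apply, smul_eq_mul, abs_mul, hs, one_mul]
  exact (LL_abs_le f x).trans hf

theorem exists_avoid (S : Finset CantorSet) :
    ∀ U : Set CantorSet, IsOpen U → U.Nonempty → ∃ x ∈ U, x ∉ S := by
  classical
  induction S using Finset.induction_on with
  | empty => intro U _ h; obtain ⟨x, hx⟩ := h; exact ⟨x, hx, by simp⟩
  | insert a S _ ih =>
    intro U hU hne
    obtain ⟨V, W, o1, o2, n1, n2, s1, s2, hd⟩ := split_open hU hne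
    by_cases ha : a ∈ V
    · obtain ⟨x, hx, hxS⟩ := ih W o2 n2
      refine ⟨x, s2 hx, ?_⟩
      rw [Finset.mem_insert, not_or]
      refine ⟨?_, hxS⟩
      rintro rfl
      exact Set.disjoint_left.1 hd ha hx
    · obtain ⟨x, hx, hxS⟩ := ih V o1 n1
      refine ⟨x, s1 hx, ?_⟩
      rw [Finset.mem_insert, not_or]
      refine ⟨?_, hxS⟩
      rintro rfl
      exact ha hx

theorem exists_points {ι : Type*} (B : ι → Set CantorSet) (J : Finset ι) :
    (∀ p ∈ J, IsOpen (B p) ∧ (B p).Nonempty) →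
    ∃ x : ι → CantorSet, (∀ p ∈ J, x p ∈ B p) ∧ Set.InjOn x J := by
  classical
  induction J using Finset.induction_on with
  | empty => intro _; exact ⟨fun _ _ => true, by simp, by simp⟩
  | insert i J hi ih =>
    intro hB
    obtain ⟨x, h1, h2⟩ := ih fun p hp => hB p (Finset.mem_insert_of_mem hp)
    obtain ⟨y, hy, hyS⟩ := exists_avoid (J.image x) (B i) (hB i (Finset.mem_insert_self _ _)).1
      (hB i (Finset.mem_insert_self _ _)).2
    have hne : ∀ p ∈ J, p ≠ i := fun p hp h => hi (h ▸ hp)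
    refine ⟨Function.update x i y, ?_, ?_⟩
    · intro p hp
      rcases Finset.mem_insert.1 hp with rfl | hp
      · simpa using hy
      · rw [Function.update_of_ne (hne p hp)]; exact h1 p hp
    · rw [Finset.coe_insert, Set.injOn_insert (by simpa using hi)]
      refine ⟨fun p hp q hq h => ?_, ?_⟩
      · rw [Function.update_of_ne (hne p hp), Function.update_of_ne (hne q hq)] at h
        exact h2 hp hq h
      · rintro ⟨p, hp, h⟩
        rw [Function.update_self, Function.update_of_ne (hne p hp)] at h
        exact hyS (h ▸ Finset.mem_image_of_mem x hp)

theorem exists_disj {ι : Type*} (B : ι → Set CantorSet) (J : Finset ι)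
    (hB : ∀ p ∈ J, IsOpen (B p) ∧ (B p).Nonempty) :
    ∃ B' : ι → Set CantorSet, (∀ p ∈ J, B' p ⊆ B p ∧ IsOpen (B' p) ∧ (B' p).Nonempty) ∧
      (J : Set ι).Pairwise fun p q => Disjoint (B' p) (B' q) := by
  obtain ⟨x, h1, h2⟩ := exists_points B J hB
  obtain ⟨U, hU, hd⟩ := ((J.finite_toSet).image x).t2_separation
  refine ⟨fun p => B p ∩ U (x p), fun p hp => ⟨Set.inter_subset_left,
    (hB p hp).1.inter (hU _).2, x p, h1 p hp, (hU _).1⟩, ?_⟩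
  intro p hp q hq hne
  exact (hd (Set.mem_image_of_mem x hp) (Set.mem_image_of_mem x hq)
    (fun h => hne (h2 hp hq h))).mono Set.inter_subset_right Set.inter_subset_right

variable {Λ : Type}

theorem Incomp.ne {p q : (ℕ → Λ) × ℕ} (h : Incomp p q) : p ≠ q := by
  rintro rfl
  obtain ⟨l, -, -, h⟩ := h
  exact h rfl

variable (D : TD Λ) (E : LL →ₗ[ℝ] (List Λ →₀ CantorC))

def Light (e : ℝ) (B : Set CantorSet) (p : (ℕ → Λ) × ℕ) : Prop :=
  ∀ f : LL, Sup B f → ‖f‖ ≤ 1 → ∀ τ ∈ D.K, (∀ l < p.2, τ l = p.1 l) → NN D (τ, p.2) (E f) < e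

def Heavy (e : ℝ) (U : Set CantorSet) (p : (ℕ → Λ) × ℕ) : Prop :=
  p.1 ∈ D.K ∧ ∃ B ⊆ U, IsOpen B ∧ B.Nonempty ∧ ∀ B' ⊆ B, IsOpen B' → B'.Nonempty →
    ¬ Light D E e B' p

variable {D E} {M : ℝ}

theorem Light.mono {e : ℝ} {B B' : Set CantorSet} {p : (ℕ → Λ) × ℕ} (h : Light D E e B p)
    (hs : B' ⊆ B) : Light D E e B' p := fun f hf => h f (hf.mono hs)

theorem nV_E_le (hE : ∀ f, nV D (E f) ≤ M * ‖f‖) {f : LL} (hf : ‖f‖ ≤ 1) :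
    nV D (E f) ^ 2 ≤ M ^ 2 := by
  rw [← sq_abs M]
  refine pow_le_pow_left₀ (apply_nonneg _ _) ((hE f).trans ?_) 2
  calc M * ‖f‖ ≤ |M| * 1 := by gcongr; exact le_abs_self M
    _ = |M| := mul_one _

theorem heavy_card (hE : ∀ f, nV D (E f) ≤ M * ‖f‖) {e : ℝ} (he : 0 ≤ e) {U : Set CantorSet}
    (I : Finset ((ℕ → Λ) × ℕ)) (hI : ∀ p ∈ I, Heavy D E e U p)
    (hp : (I : Set ((ℕ → Λ) × ℕ)).Pairwise Incomp) : I.card * e ^ 2 ≤ M ^ 2 := by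
  classical
  have h0 : ∀ p, ∃ B : Set CantorSet, p ∈ I → (IsOpen B ∧ B.Nonempty ∧ ∀ B' ⊆ B, IsOpen B' →
      B'.Nonempty → ¬ Light D E e B' p) := by
    intro p
    by_cases hpI : p ∈ I
    · obtain ⟨-, B, -, h2, h3, h4⟩ := hI p hpI
      exact ⟨B, fun _ => ⟨h2, h3, h4⟩⟩
    · exact ⟨∅, fun h => absurd h hpI⟩
  choose B hB using h0
  obtain ⟨B', hB', hd⟩ := exists_disj B I fun p hp => ⟨(hB p hp).1, (hB p hp).2.1⟩
  have h1 : ∀ p, ∃ (f : LL) (τ : ℕ → Λ), p ∈ I → (Sup (B' p) f ∧ ‖f‖ ≤ 1 ∧ τ ∈ D.K ∧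
      (∀ l < p.2, τ l = p.1 l) ∧ e ≤ NN D (τ, p.2) (E f)) := by
    intro p
    by_cases hpI : p ∈ I
    · have := (hB p hpI).2.2 (B' p) (hB' p hpI).1 (hB' p hpI).2.1 (hB' p hpI).2.2
      unfold Light at this
      push Not at this
      obtain ⟨f, h1, h2, τ, h3, h4, h5⟩ := this
      exact ⟨f, τ, fun _ => ⟨h1, h2, h3, h4, h5⟩⟩
    · exact ⟨0, p.1, fun h => absurd h hpI⟩
  choose f τ hf using h1
  have key : ∀ S ⊆ I, ∃ F : LL, Sup (⋃ p ∈ S, B' p) F ∧ ‖F‖ ≤ 1 ∧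
      S.card * e ^ 2 ≤ ∑ p ∈ S, (NN D (τ p, p.2) (E F)) ^ 2 := by
    intro S
    induction S using Finset.induction_on with
    | empty => intro _; exact ⟨0, fun _ _ => rfl, by simp, by simp⟩
    | insert a S ha ih =>
      intro hS
      have haI : a ∈ I := hS (Finset.mem_insert_self _ _)
      have hSI : S ⊆ I := fun p hp => hS (Finset.mem_insert_of_mem hp)
      obtain ⟨F, h1, h2, h3⟩ := ih hSI
      obtain ⟨s, hs, hs2⟩ := sign_step (fun p : (ℕ → Λ) × ℕ => NN D (τ p, p.2))
        (NN D (τ a, a.2)) S (E F) (E (f a))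
      have hfa := hf a haI
      refine ⟨F + s • f a, ?_, ?_, ?_⟩
      · rw [Finset.set_biUnion_insert]
        exact (h1.mono Set.subset_union_right).add ((hfa.1.mono Set.subset_union_left).smul s)
      · refine norm_disj h1 (hfa.1.smul s) ?_ h2 ?_
        · simp only [Set.disjoint_iUnion_left]
          intro p hp
          exact hd (hSI hp) haI (fun h => ha (h ▸ hp))
        · exact norm_smul_LL hs hfa.2.1
      · rw [Finset.sum_insert ha, Finset.card_insert_of_notMem ha, map_add, map_smul]
        have h4 : e ^ 2 ≤ NN D (τ a, a.2) (E (f a)) ^ 2 := pow_le_pow_left₀ he hfa.2.2.2.2 2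
        push_cast
        linarith
  obtain ⟨F, -, h2, h3⟩ := key I le_rfl
  have hinc : ∀ p ∈ I, ∀ q ∈ I, p ≠ q → Incomp (τ p, p.2) (τ q, q.2) := by
    intro p hpI q hq hne
    obtain ⟨l, a, b, c⟩ := hp hpI hq hne
    refine ⟨l, a, b, ?_⟩
    change τ p l ≠ τ q l
    rw [(hf p hpI).2.2.2.1 l a, (hf q hq).2.2.2.1 l b]; exact c
  have hinj : Set.InjOn (fun p : (ℕ → Λ) × ℕ => (τ p, p.2)) I := by
    intro p hpI q hq h
    by_contra hne
    exact (hinc p hpI q hq hne).ne h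
  have hfam : IsFam D (I.image fun p : (ℕ → Λ) × ℕ => (τ p, p.2)) := by
    refine ⟨?_, ?_⟩
    · intro r hr
      obtain ⟨p, hpI, rfl⟩ := Finset.mem_image.1 hr
      exact (hf p hpI).2.2.1
    · intro r hr r' hr' hne
      obtain ⟨p, hpI, rfl⟩ := Finset.mem_image.1 (Finset.mem_coe.1 hr)
      obtain ⟨q, hqI, rfl⟩ := Finset.mem_image.1 (Finset.mem_coe.1 hr')
      exact hinc p hpI q hqI (fun h => hne (by rw [h]))
  have h5 := sqs_le D (E F) hfam
  rw [sqs, Finset.sum_image hinj] at h5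
  exact (h3.trans h5).trans (nV_E_le hE h2)

theorem chain_branch (hK : ∀ σ, (∀ n, ∃ τ ∈ D.K, ∀ l < n, τ l = σ l) → σ ∈ D.K)
    (H : Set ((ℕ → Λ) × ℕ)) (hne : H.Nonempty) (hHK : ∀ q ∈ H, q.1 ∈ D.K)
    (hc : ∀ q ∈ H, ∀ q' ∈ H, ¬ Incomp q q') :
    ∃ β ∈ D.K, ∀ q ∈ H, ∀ l < q.2, β l = q.1 l := by
  have hc' : ∀ q ∈ H, ∀ q' ∈ H, ∀ l, l < q.2 → l < q'.2 → q.1 l = q'.1 l := by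
    intro q hq q' hq' l h1 h2
    by_contra h
    exact hc q hq q' hq' ⟨l, h1, h2, h⟩
  by_cases hb : ∃ N, ∀ q ∈ H, q.2 ≤ N
  · obtain ⟨N, hN⟩ := hb
    have hmem : sSup (Prod.snd '' H) ∈ Prod.snd '' H :=
      Nat.sSup_mem (hne.image _) ⟨N, by rintro _ ⟨q, hq, rfl⟩; exact hN q hq⟩
    obtain ⟨q, hq, hqs⟩ := hmem
    refine ⟨q.1, hHK q hq, fun r hr l hl => hc' q hq r hr l ?_ hl⟩
    rw [hqs]
    exact hl.trans_le (le_csSup ⟨N, by rintro _ ⟨q, hq, rfl⟩; exact hN q hq⟩ ⟨r, hr, rfl⟩)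
  · push Not at hb
    choose q hq hlt using hb
    refine ⟨fun l => (q l).1 l, hK _ fun n => ⟨(q n).1, hHK _ (hq n), fun l hl =>
      hc' _ (hq n) _ (hq l) l (hl.trans (hlt n)) (hlt l)⟩, fun r hr l hl =>
      hc' _ (hq l) _ hr l (hlt l) hl⟩

theorem heavy_fin (hK : ∀ σ, (∀ n, ∃ τ ∈ D.K, ∀ l < n, τ l = σ l) → σ ∈ D.K)
    (hE : ∀ f, nV D (E f) ≤ M * ‖f‖) {e : ℝ} (he : 0 < e) (U : Set CantorSet) :
    ∃ F0 : Finset (ℕ → Λ), (∀ σ ∈ F0, σ ∈ D.K) ∧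
      ∀ q, Heavy D E e U q → ∃ σ ∈ F0, ∀ l < q.2, σ l = q.1 l := by
  classical
  let P : Finset ((ℕ → Λ) × ℕ) → Prop := fun I => (∀ p ∈ I, Heavy D E e U p) ∧
    (I : Set ((ℕ → Λ) × ℕ)).Pairwise Incomp
  obtain ⟨N, hN⟩ := exists_nat_gt (M ^ 2 / e ^ 2)
  have hbd : ∀ I, P I → I.card ≤ N := by
    intro I hI
    have h1 := heavy_card hE he.le I hI.1 hI.2
    rw [div_lt_iff₀ (by positivity)] at hN
    have h2 : (I.card : ℝ) < N := lt_of_mul_lt_mul_right (h1.trans_lt hN) (by positivity)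
    exact_mod_cast h2.le
  have hmem : sSup {n | ∃ I, P I ∧ I.card = n} ∈ {n | ∃ I, P I ∧ I.card = n} :=
    Nat.sSup_mem ⟨0, ∅, ⟨by simp, by simp⟩, by simp⟩
      ⟨N, by rintro _ ⟨I, hI, rfl⟩; exact hbd I hI⟩
  obtain ⟨I, hI, hIc⟩ := hmem
  have hmax : ∀ J, P J → J.card ≤ I.card := by
    intro J hJ
    rw [hIc]
    exact le_csSup ⟨N, by rintro _ ⟨I, hI, rfl⟩; exact hbd I hI⟩ ⟨J, hJ, rfl⟩
  let H : (ℕ → Λ) × ℕ → Set ((ℕ → Λ) × ℕ) := fun p =>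
    {q | Heavy D E e U q ∧ p.2 ≤ q.2 ∧ ∀ l < p.2, q.1 l = p.1 l}
  have hH : ∀ p ∈ I, ∃ β ∈ D.K, ∀ q ∈ H p, ∀ l < q.2, β l = q.1 l := by
    intro p hp
    refine chain_branch hK (H p) ⟨p, hI.1 p hp, le_rfl, fun _ _ => rfl⟩ (fun q hq => hq.1.1) ?_
    rintro q ⟨hq1, hq2, hq3⟩ q' ⟨hq1', hq2', hq3'⟩ hinc
    have haux : ∀ q, p.2 ≤ q.2 → (∀ l < p.2, q.1 l = p.1 l) → ∀ r ∈ I.erase p, Incomp q r := by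
      intro q h2 h3 r hr
      obtain ⟨hr1, hr2⟩ := Finset.mem_erase.1 hr
      obtain ⟨l, a, b, c⟩ := hI.2 hp hr2 hr1.symm
      exact ⟨l, a.trans_le h2, b, by rw [h3 l a]; exact c⟩
    have hn1 : q' ∉ I.erase p := fun h => (haux q' hq2' hq3' q' h).ne rfl
    have hn2 : q ∉ insert q' (I.erase p) := by
      intro h
      rcases Finset.mem_insert.1 h with h | h
      · exact hinc.ne h
      · exact (haux q hq2 hq3 q h).ne rfl
    have := hmax (insert q (insert q' (I.erase p))) ⟨?_, ?_⟩
    · rw [Finset.card_insert_of_notMem hn2, Finset.card_insert_of_notMem hn1,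
        Finset.card_erase_of_mem hp] at this
      have : 0 < I.card := Finset.card_pos.2 ⟨p, hp⟩
      omega
    · intro r hr
      rcases Finset.mem_insert.1 hr with rfl | hr
      · exact hq1
      rcases Finset.mem_insert.1 hr with rfl | hr
      · exact hq1'
      exact hI.1 r (Finset.mem_of_mem_erase hr)
    · rw [Finset.coe_insert, Finset.coe_insert]
      refine Set.Pairwise.insert (Set.Pairwise.insert ?_ ?_) ?_
      · exact hI.2.mono (by exact_mod_cast Finset.erase_subset p I)
      · intro r hr _
        exact ⟨haux q' hq2' hq3' r hr, (haux q' hq2' hq3' r hr).symm⟩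
      · intro r hr _
        rcases hr with rfl | hr
        · exact ⟨hinc, hinc.symm⟩
        · exact ⟨haux q hq2 hq3 r hr, (haux q hq2 hq3 r hr).symm⟩
  have hH' : ∀ p, ∃ β, p ∈ I → (β ∈ D.K ∧ ∀ q ∈ H p, ∀ l < q.2, β l = q.1 l) := by
    intro p
    by_cases hp : p ∈ I
    · obtain ⟨β, h⟩ := hH p hp
      exact ⟨β, fun _ => h⟩
    · exact ⟨p.1, fun h => absurd h hp⟩
  choose β hβ using hH'
  have hβ1 := fun p hp => (hβ p hp).1
  have hβ2 := fun p hp => (hβ p hp).2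
  refine ⟨I.image β, ?_, ?_⟩
  · intro σ hσ
    obtain ⟨p, hp, rfl⟩ := Finset.mem_image.1 hσ
    exact hβ1 p hp
  · intro q hq
    have : ∃ p ∈ I, ¬ Incomp q p := by
      by_contra hcon
      push Not at hcon
      have hn : q ∉ I := fun h => (hcon q h).ne rfl
      have := hmax (insert q I) ⟨?_, ?_⟩
      · rw [Finset.card_insert_of_notMem hn] at this
        omega
      · intro r hr
        rcases Finset.mem_insert.1 hr with rfl | hr
        · exact hq
        · exact hI.1 r hr
      · rw [Finset.coe_insert]
        exact Set.Pairwise.insert hI.2 fun r hr _ => ⟨hcon r hr, (hcon r hr).symm⟩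
    obtain ⟨p, hp, hn⟩ := this
    have hagr : ∀ l, l < q.2 → l < p.2 → q.1 l = p.1 l := by
      intro l h1 h2
      by_contra h
      exact hn ⟨l, h1, h2, h⟩
    refine ⟨β p, Finset.mem_image_of_mem β hp, fun l hl => ?_⟩
    rcases le_total p.2 q.2 with h | h
    · exact hβ2 p hp q ⟨hq, h, fun l hl => hagr l (hl.trans_le h) hl⟩ l hl
    · rw [hβ2 p hp p ⟨hI.1 p hp, le_rfl, fun _ _ => rfl⟩ l (hl.trans_le h), hagr l hl (hl.trans_le h)]

theorem NN_split {σ τ : ℕ → Λ} {L : ℕ} (h : ∀ l < L, σ l = τ l) (z : List Λ →₀ CantorC) :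
    NN D (τ, 0) z ≤ NN D (σ, 0) z + NN D (τ, L+1) z := by
  rw [NN_zero, NN_zero, NN_apply]
  have h1 : cut L (crd τ z) = cut L (crd σ z) := by
    ext1 n
    rw [cut_apply, cut_apply]
    split_ifs with hn
    · rw [crd_apply, crd_apply, nd_eq.2 ⟨rfl, fun l hl => (h l (by omega)).symm⟩]
    · rfl
  have h2 := Hn_cut_le (D.hX σ) (D.mono τ) L (fun k hk => (D.loc σ τ k fun l hl =>
    h l (by omega)).le) (crd σ z)
  have h3 := map_add_le_add (Hn (D.X τ)) (cut L (crd τ z)) (tl (L+1) (crd τ z))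
  rw [tl_succ, h1] at h3
  change _ ≤ _ + Hn (D.X τ) (tl (L+1) (crd τ z))
  linarith

theorem L3 (hK : ∀ σ, (∀ n, ∃ τ ∈ D.K, ∀ l < n, τ l = σ l) → σ ∈ D.K)
    (hnu : ∀ σ ∈ D.K, ¬ Embeds CantorC (⨆ n, D.X σ n).topologicalClosure)
    (hE : ∀ f, nV D (E f) ≤ M * ‖f‖) {U : Set CantorSet} (hU : IsOpen U) (hne : U.Nonempty)
    {ε : ℝ} (hε : 0 < ε) : ∃ g, Nz U g ∧ ∀ σ ∈ D.K, NN D (σ, 0) (E g) < ε := by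
  classical
  by_contra hcon
  push Not at hcon
  set e := ε / 2 with he
  have he0 : 0 < e := by positivity
  obtain ⟨F0, hF0, hheavy⟩ := heavy_fin hK hE he0 U
  let Off : (ℕ → Λ) → ℕ → Prop := fun τ n => ∀ σ ∈ F0, ∃ l < n, σ l ≠ τ l
  have key : ∀ n : ℕ, ∃ (I : Finset ((ℕ → Λ) × ℕ)) (F : LL) (B : Set CantorSet),
      IsFam D I ∧ B ⊆ U ∧ IsOpen B ∧ B.Nonempty ∧ Sup Bᶜ F ∧ ‖F‖ ≤ 1 ∧
      n * e ^ 2 ≤ sqs D I (E F) ∧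
      ∀ p ∈ I, Off p.1 p.2 ∧ (∀ k < p.2, ¬ Off p.1 k) ∧ Light D E e B p := by
    intro n
    induction n with
    | zero => exact ⟨∅, 0, U, isFam_empty D, le_rfl, hU, hne, fun _ _ => rfl, by simp,
        by simp [sqs], by simp⟩
    | succ n ih =>
      obtain ⟨I, F, B, hI, hBU, hBo, hBn, hFB, hF1, hsum, hp⟩ := ih
      obtain ⟨V, W, o1, o2, n1, n2, s1, s2, hd⟩ := split_open hBo hBn
      obtain ⟨f, hfN, hf⟩ := L2 hnu hE F0 hF0 V o1 n1 e he0
      obtain ⟨τ, hτ, hτε⟩ := hcon f ⟨hfN.1.mono (s1.trans hBU), hfN.2⟩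
      have hex : ∃ m, Off τ m := by
        have : ∀ σ ∈ F0, ∃ l, σ l ≠ τ l := by
          intro σ hσ
          by_contra h
          push Not at h
          have := hf σ hσ
          rw [funext h] at this
          linarith
        choose! l hl using this
        exact ⟨F0.sup l + 1, fun σ hσ => ⟨l σ, Nat.lt_succ_of_le (Finset.le_sup hσ), hl σ hσ⟩⟩
      set m := Nat.find hex with hm
      have hm1 : Off τ m := Nat.find_spec hex
      have hm2 : ∀ k < m, ¬ Off τ k := fun k hk => Nat.find_min hex hk
      have hbig : e ≤ NN D (τ, m) (E f) := by
        rcases Nat.eq_zero_or_pos m with h0 | h0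
        · rw [h0]; linarith
        · obtain ⟨L, hL⟩ : ∃ L, m = L + 1 := ⟨m - 1, by omega⟩
          have := hm2 L (by omega)
          simp only [Off] at this
          push Not at this
          obtain ⟨σ, hσ, h⟩ := this
          have h1 := NN_split (D := D) h (E f)
          have h2 := hf σ hσ
          rw [hL]
          linarith
      have hlight : ∃ B' ⊆ W, IsOpen B' ∧ B'.Nonempty ∧ Light D E e B' (τ, m) := by
        by_contra hc
        push Not at hc
        obtain ⟨σ, hσ, h⟩ := hheavy (τ, m) ⟨hτ, W, s2.trans (hBU), o2, n2, hc⟩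
        obtain ⟨l, h1, h2⟩ := hm1 σ hσ
        exact h2 (h l h1)
      obtain ⟨B', hB'W, hB'o, hB'n, hB'l⟩ := hlight
      have hinc : ∀ p ∈ I, Incomp (τ, m) p := by
        intro p hpI
        obtain ⟨h1, h2, h3⟩ := hp p hpI
        by_contra hni
        have hagr : ∀ l, l < m → l < p.2 → τ l = p.1 l := by
          intro l a b
          by_contra h
          exact hni ⟨l, a, b, h⟩
        have hmp : m = p.2 := by
          rcases lt_trichotomy m p.2 with h | h | h
          · refine absurd ?_ (h2 m h)
            intro σ hσ
            obtain ⟨l, a, b⟩ := hm1 σ hσ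
            exact ⟨l, a, by rw [← hagr l a (a.trans h)]; exact b⟩
          · exact h
          · refine absurd ?_ (hm2 p.2 h)
            intro σ hσ
            obtain ⟨l, a, b⟩ := h1 σ hσ
            exact ⟨l, a, by rw [hagr l (a.trans h) a]; exact b⟩
        have := h3 f (hfN.1.mono s1) hfN.norm_le τ hτ (fun l hl => hagr l (by omega) hl)
        rw [← hmp] at this
        linarith
      have hnI : (τ, m) ∉ I := fun h => (hinc _ h).ne rfl
      obtain ⟨s, hs, hs2⟩ := sign_step (fun p : (ℕ → Λ) × ℕ => NN D p) (NN D (τ, m)) I (E F) (E f)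
      refine ⟨insert (τ, m) I, F + s • f, B', ⟨?_, ?_⟩, hB'W.trans (s2.trans hBU), hB'o, hB'n,
        ?_, ?_, ?_, ?_⟩
      · intro p hp'
        rcases Finset.mem_insert.1 hp' with rfl | hp'
        · exact hτ
        · exact hI.1 p hp'
      · rw [Finset.coe_insert]
        exact Set.Pairwise.insert hI.2 fun r hr _ => ⟨hinc r hr, (hinc r hr).symm⟩
      · refine (hFB.mono ?_).add ((hfN.1.mono ?_).smul s)
        · exact Set.compl_subset_compl.2 (hB'W.trans s2)
        · exact fun x hx hx' => Set.disjoint_left.1 hd hx (hB'W hx')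
      · refine norm_disj (B := V) hFB (hfN.1.smul s) ?_ hF1 ?_
        · exact Set.disjoint_left.2 fun x hx hx' => hx (s1 hx')
        · exact norm_smul_LL hs hfN.norm_le
      · rw [sqs, Finset.sum_insert hnI, map_add, map_smul]
        rw [sqs] at hsum
        have h4 : e ^ 2 ≤ NN D (τ, m) (E f) ^ 2 := pow_le_pow_left₀ he0.le hbig 2
        push_cast
        linarith
      · intro p hp'
        rcases Finset.mem_insert.1 hp' with rfl | hp'
        · exact ⟨hm1, hm2, hB'l⟩
        · exact ⟨(hp p hp').1, (hp p hp').2.1, (hp p hp').2.2.mono (hB'W.trans s2)⟩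
  obtain ⟨N, hN⟩ := exists_nat_gt (M ^ 2 / e ^ 2)
  obtain ⟨I, F, B, hI, -, -, -, -, h1, h2, -⟩ := key N
  rw [div_lt_iff₀ (by positivity)] at hN
  linarith [sqs_le D (E F) hI, nV_E_le hE h1]

open Classical in
theorem card_ne {I : Finset ((ℕ → Λ) × ℕ)} (hI : IsFam D I) (z : List Λ →₀ CantorC) :
    (I.filter fun p => NN D p z ≠ 0).card ≤ z.support.card := by
  refine le_trans (Finset.card_le_card ?_) (card_meet hI z.support)
  intro p hp
  rw [Finset.mem_filter] at *
  obtain ⟨n, h1, h2⟩ := NN_ne_zero hp.2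
  exact ⟨hp.1, n, h1, by simpa using h2⟩

theorem nV_add_le (Y y : List Λ →₀ CantorC) {η : ℝ}
    (hy : ∀ σ ∈ D.K, NN D (σ, 0) y ≤ η) (hη : 0 ≤ η) :
    nV D (Y + y) ^ 2 ≤ nV D Y ^ 2 + nV D y ^ 2 + Y.support.card * (4 * η * nV D Y) := by
  classical
  have hpos := apply_nonneg (nV D) Y
  have hB : 0 ≤ nV D Y ^ 2 + nV D y ^ 2 + Y.support.card * (4 * η * nV D Y) :=
    add_nonneg (add_nonneg (sq_nonneg _) (sq_nonneg _))
      (mul_nonneg (Nat.cast_nonneg _) (mul_nonneg (by linarith) hpos))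
  refine nV_sq_le D _ hB fun I hI => ?_
  have h1 : sqs D I (Y + y) ≤ sqs D I Y + sqs D I y + ∑ p ∈ I, 2 * (NN D p Y * NN D p y) := by
    unfold sqs
    rw [← Finset.sum_add_distrib, ← Finset.sum_add_distrib]
    refine Finset.sum_le_sum fun p _ => ?_
    have := pow_le_pow_left₀ (apply_nonneg _ _) (map_add_le_add (NN D p) Y y) 2
    linarith [add_sq (NN D p Y) (NN D p y)]
  have h2 : ∑ p ∈ I, 2 * (NN D p Y * NN D p y) ≤ Y.support.card * (4 * η * nV D Y) := by
    have e : ∑ p ∈ I, 2 * (NN D p Y * NN D p y) =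
        ∑ p ∈ I.filter (fun p => NN D p Y ≠ 0), 2 * (NN D p Y * NN D p y) := by
      rw [Finset.sum_filter]
      refine Finset.sum_congr rfl fun p _ => ?_
      split_ifs with h
      · rfl
      · rw [not_not.1 h]; ring
    rw [e]
    have h3 : ∑ p ∈ I.filter (fun p => NN D p Y ≠ 0), 2 * (NN D p Y * NN D p y) ≤
        ∑ p ∈ I.filter (fun p => NN D p Y ≠ 0), (4 * η * nV D Y) := by
      refine Finset.sum_le_sum fun p hp => ?_
      have hpK := hI.1 p (Finset.mem_filter.1 hp).1
      have a1 := NN_le_nV D hpK Y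
      have a2 := NN_le_two D p.1 p.2 y
      have a3 := hy p.1 hpK
      have : NN D p Y * NN D p y ≤ nV D Y * (2 * η) :=
        mul_le_mul a1 (by linarith) (apply_nonneg _ _) hpos
      linarith
    refine h3.trans ?_
    rw [Finset.sum_const, nsmul_eq_mul]
    refine mul_le_mul_of_nonneg_right ?_ (by positivity)
    exact_mod_cast card_ne hI Y
  linarith [sqs_le D Y hI, sqs_le D y hI]

theorem noUniv (hK : ∀ σ, (∀ n, ∃ τ ∈ D.K, ∀ l < n, τ l = σ l) → σ ∈ D.K)
    (hnu : ∀ σ ∈ D.K, ¬ Embeds CantorC (⨆ n, D.X σ n).topologicalClosure)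
    (hE : ∀ f, nV D (E f) ≤ M * ‖f‖) {c : ℝ} (hc : 0 < c) (hlow : ∀ f, c * ‖f‖ ≤ nV D (E f)) :
    False := by
  have key : ∀ n : ℕ, ∃ (F : LL) (A : Set CantorSet), IsOpen A ∧ A.Nonempty ∧
      (∀ x ∈ A, (F : CantorC) x = n) ∧ nV D (E F) ^ 2 ≤ n * (M ^ 2 + 1) := by
    intro n
    induction n with
    | zero => exact ⟨0, Set.univ, isOpen_univ, Set.univ_nonempty, by simp, by simp⟩
    | succ n ih =>
      obtain ⟨F, A, hA, hAn, hFA, hF⟩ := ih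
      set Q : ℝ := (E F).support.card * (4 * nV D (E F)) with hQ
      have hQ0 : 0 ≤ Q := by have := apply_nonneg (nV D) (E F); positivity
      obtain ⟨g, hg, hgs⟩ := L3 hK hnu hE hA hAn (ε := 1 / (Q + 1)) (by positivity)
      obtain ⟨x, hx⟩ := hg.2.2
      refine ⟨F + g, {x | (g : CantorC) x = 1}, isOpen_level g.2 1, ⟨x, hx⟩, ?_, ?_⟩
      · intro y hy
        have hy' : (g : CantorC) y = 1 := hy
        have hyA : y ∈ A := by
          by_contra h
          rw [hg.1 y h] at hy'
          norm_num at hy'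
        simp [hFA y hyA, hy']
      · rw [map_add]
        have h1 := nV_add_le (D := D) (E F) (E g) (η := 1 / (Q + 1)) (fun σ hσ => (hgs σ hσ).le)
          (by positivity)
        have h2 := nV_E_le hE hg.norm_le
        have h3 : (E F).support.card * (4 * (1 / (Q + 1)) * nV D (E F)) ≤ 1 := by
          have : (E F).support.card * (4 * (1 / (Q + 1)) * nV D (E F)) = Q / (Q + 1) := by
            rw [hQ]; ring
          rw [this, div_le_one (by positivity)]
          linarith
        push_cast
        linarith
  obtain ⟨n, hn⟩ := exists_nat_gt ((M ^ 2 + 1) / c ^ 2)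
  obtain ⟨F, A, -, ⟨x, hx⟩, hF, hle⟩ := key n
  have h1 : (n : ℝ) ≤ ‖F‖ := by
    have := LL_abs_le F x
    rw [hF x hx] at this
    exact (le_abs_self _).trans this
  have h2 : (c * n) ^ 2 ≤ nV D (E F) ^ 2 :=
    pow_le_pow_left₀ (by positivity) ((mul_le_mul_of_nonneg_left h1 hc.le).trans (hlow F)) 2
  rw [div_lt_iff₀ (by positivity)] at hn
  have hn0 : 0 < (n : ℝ) := by
    by_contra h
    have h0 : (n : ℝ) = 0 := le_antisymm (not_lt.1 h) (by positivity)
    rw [h0] at hn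
    nlinarith [sq_nonneg M]
  nlinarith

end
end BB

namespace BB
noncomputable section

variable {Λ : Type}

/-- the amalgam before completion -/
def VV (_ : TD Λ) : Type := List Λ →₀ CantorC

variable (D : TD Λ)

instance : AddCommGroup (VV D) := inferInstanceAs (AddCommGroup (List Λ →₀ CantorC))
instance : Module ℝ (VV D) := inferInstanceAs (Module ℝ (List Λ →₀ CantorC))
instance : SeminormedAddCommGroup (VV D) :=
  AddGroupSeminorm.toSeminormedAddCommGroup (E := VV D) (nV D).toAddGroupSeminorm

theorem VV_norm (z : List Λ →₀ CantorC) : ‖(show VV D from z)‖ = nV D z := rfl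

instance : NormedSpace ℝ (VV D) where
  norm_smul_le c z := (map_smul_eq_mul (nV D) c z).le

/-- linear identification -/
def toVV : (List Λ →₀ CantorC) →ₗ[ℝ] VV D := LinearMap.id

theorem toVV_norm (z : List Λ →₀ CantorC) : ‖toVV D z‖ = nV D z := rfl

theorem nV_single_le (t : List Λ) (f : CantorC) : nV D (Finsupp.single t f) ≤ 2 * ‖f‖ := by
  refine le_of_sq_le_sq ?_ (by positivity)
  refine nV_sq_le D _ (by positivity) fun I hI => (sqs_bdd hI _).trans ?_
  have h1 : ∑ s ∈ (Finsupp.single t f).support, ‖Finsupp.single t f s‖ ≤ ‖f‖ := by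
    refine (Finset.sum_le_sum_of_subset_of_nonneg Finsupp.support_single_subset
      (fun _ _ _ => norm_nonneg _)).trans ?_
    simp
  have h2 : (Finsupp.single t f).support.card ≤ 1 :=
    (Finset.card_le_card Finsupp.support_single_subset).trans (by simp)
  have h3 : 0 ≤ ∑ s ∈ (Finsupp.single t f).support, ‖Finsupp.single t f s‖ :=
    Finset.sum_nonneg fun _ _ => norm_nonneg _
  calc ((Finsupp.single t f).support.card : ℝ) *
        (2 * ∑ s ∈ (Finsupp.single t f).support, ‖Finsupp.single t f s‖) ^ 2
      ≤ 1 * (2 * ‖f‖) ^ 2 := by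
        refine mul_le_mul (by exact_mod_cast h2) ?_ (sq_nonneg _) zero_le_one
        exact pow_le_pow_left₀ (mul_nonneg zero_le_two h3) (mul_le_mul_of_nonneg_left h1 zero_le_two) 2
    _ = _ := one_mul _

instance [Countable Λ] : TopologicalSpace.SeparableSpace (VV D) := by
  rw [← TopologicalSpace.isSeparable_univ_iff]
  have h1 : ∀ t : List Λ, TopologicalSpace.IsSeparable
      (Set.range ((toVV D) ∘ₗ (Finsupp.lsingle t : CantorC →ₗ[ℝ] (List Λ →₀ CantorC)))) := fun t =>
    TopologicalSpace.isSeparable_range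
      (AddMonoidHomClass.continuous_of_bound _ 2 fun f => nV_single_le D t f)
  have h2 := (TopologicalSpace.IsSeparable.iUnion h1).span (R := ℝ)
  refine h2.mono fun z _ => ?_
  obtain ⟨w, rfl⟩ : ∃ w : List Λ →₀ CantorC, toVV D w = z := ⟨z, rfl⟩
  rw [← Finsupp.sum_single w, Finsupp.sum, map_sum]
  refine Submodule.sum_mem _ fun t _ => Submodule.subset_span ?_
  exact Set.mem_iUnion.2 ⟨t, _, rfl⟩

theorem denseRange_WW (σ : ℕ → Λ) (P : WW (D.X σ) →ₗ[ℝ] (⨆ n, D.X σ n).topologicalClosure)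
    (hP : ∀ w, (P w : CantorC) = sm w.1) : DenseRange P := by
  intro y
  rw [closure_subtype]
  have hy : (y : CantorC) ∈ closure ((⨆ n, D.X σ n : Submodule ℝ CantorC) : Set CantorC) := y.2
  refine closure_mono ?_ hy
  intro x hx
  rw [SetLike.mem_coe, Submodule.mem_iSup_of_directed _ (D.mono σ).directed_le] at hx
  obtain ⟨n, hn⟩ := hx
  have hw : Finsupp.single n x ∈ WW (D.X σ) := by
    intro m
    by_cases h : m = n
    · subst h; simpa using hn
    · rw [Finsupp.single_eq_of_ne h]; exact zero_mem _
  refine ⟨P ⟨_, hw⟩, ⟨_, rfl⟩, ?_⟩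
  rw [hP]
  simp [sm]

theorem embeds_branch {σ : ℕ → Λ} (hσ : σ ∈ D.K) :
    Embeds (⨆ n, D.X σ n).topologicalClosure (UniformSpace.Completion (VV D)) := by
  have hmem : ∀ w : WW (D.X σ), (sm ∘ₗ (WW (D.X σ)).subtype) w ∈
      (⨆ n, D.X σ n).topologicalClosure := by
    intro w
    refine Submodule.le_topologicalClosure _ ?_
    obtain ⟨m, hm⟩ := sq_bound w.1
    change sm w.1 ∈ _
    rw [sm_eq hm]
    exact Submodule.sum_mem _ fun n _ => Submodule.mem_iSup_of_mem n (w.2 n)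
  refine extEmb (M := WW (D.X σ)) ((sm ∘ₗ (WW (D.X σ)).subtype).codRestrict _ hmem)
    (denseRange_WW D σ _ fun w => rfl)
    ((UniformSpace.Completion.toComplL (𝕜 := ℝ) (E := VV D)).toLinearMap ∘ₗ toVV D ∘ₗ kap σ ∘ₗ
      (WW (D.X σ)).subtype) (c := 1) (C := 2) one_pos ?_ ?_
  · intro w
    change 1 * ‖sm w.1‖ ≤ ‖((toVV D (kap σ w.1) : VV D) : UniformSpace.Completion (VV D))‖
    rw [UniformSpace.Completion.norm_coe, toVV_norm, one_mul]
    exact le_nV_kap D hσ w.2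
  · intro w
    change ‖((toVV D (kap σ w.1) : VV D) : UniformSpace.Completion (VV D))‖ ≤ 2 * ‖sm w.1‖
    rw [UniformSpace.Completion.norm_coe, toVV_norm]
    exact nV_kap_le D σ w.2

variable {D}

theorem amalgam_nonuniv (hK : ∀ σ, (∀ n, ∃ τ ∈ D.K, ∀ l < n, τ l = σ l) → σ ∈ D.K)
    (hnu : ∀ σ ∈ D.K, ¬ Embeds CantorC (⨆ n, D.X σ n).topologicalClosure) :
    ¬ Embeds CantorC (UniformSpace.Completion (VV D)) := by
  rintro ⟨T, c, hc, hT⟩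
  obtain ⟨g, -, hg⟩ := lemmaA' (fun _ _ => True) (fun k U h1 h2 => by
    obtain ⟨g, hg⟩ := exists_bump h1 h2
    exact ⟨g, hg, trivial⟩) isOpen_univ Set.univ_nonempty
  let ι := (UniformSpace.Completion.toComplL (𝕜 := ℝ) (E := VV D)).toLinearMap
  have hz : ∀ k, ∃ z : VV D, ‖ι z - T (g k)‖ ≤ (c/2)/4*(1/2)^k := by
    intro k
    have hpos : 0 < (c/2)/4*(1/2)^k := by positivity
    obtain ⟨z, hz⟩ := UniformSpace.Completion.denseRange_coe (α := VV D) |>.exists_dist_lt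
      (T (g k)) hpos
    refine ⟨z, ?_⟩
    rw [← dist_eq_norm, dist_comm]
    exact hz.le
  choose z hz using hz
  have hclose : ∀ f, ‖ι (Phi z f) - T (Phi g f)‖ ≤ c/2 * ‖f‖ := by
    intro f
    have e : ι (Phi z f) - T (Phi g f) = Phi (fun k => ι (z k) - T (g k)) f := by
      rw [← Phi_sub, map_Phi]
      congr 1
      exact map_Phi (T.toLinearMap ∘ₗ LL.subtype) g f
    rw [e]
    exact Phi_small (ε := c/2) (normSeminorm ℝ (UniformSpace.Completion (VV D)))
      (fun k => ι (z k) - T (g k)) hz (by positivity) f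
  have hι : ∀ f, ‖ι (Phi z f)‖ = nV D (Phi z f) := by
    intro f
    exact UniformSpace.Completion.norm_coe _
  refine noUniv (D := D) (E := (Phi z : LL →ₗ[ℝ] VV D)) hK hnu (M := ‖T‖ * 3 + c/2) ?_
    (c := c/2) (by positivity) ?_
  · intro f
    change nV D (Phi z f) ≤ _
    rw [← hι]
    have h1 := norm_sub_norm_le (ι (Phi z f)) (T (Phi g f))
    have h2 := T.le_opNorm (Phi g f)
    have h3 : ‖T‖ * ‖(Phi g f : CantorC)‖ ≤ ‖T‖ * (3 * ‖f‖) :=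
      mul_le_mul_of_nonneg_left (hg f).2.1 (norm_nonneg _)
    linarith [hclose f]
  · intro f
    change _ ≤ nV D (Phi z f)
    rw [← hι]
    have h1 := norm_sub_norm_le (T (Phi g f)) (ι (Phi z f))
    rw [norm_sub_rev] at h1
    have h2 := hT (Phi g f)
    have h3 : c * ‖f‖ ≤ c * ‖(Phi g f : CantorC)‖ := mul_le_mul_of_nonneg_left (hg f).1 hc.le
    linarith [hclose f]

end
end BB

namespace BB
noncomputable section

theorem embeds_trans {X Y Z : Type*} [SeminormedAddCommGroup X] [NormedSpace ℝ X]
    [SeminormedAddCommGroup Y] [NormedSpace ℝ Y] [SeminormedAddCommGroup Z] [NormedSpace ℝ Z]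
    (h1 : Embeds X Y) (h2 : Embeds Y Z) : Embeds X Z := by
  obtain ⟨T, c, hc, hT⟩ := h1
  obtain ⟨S, e, he, hS⟩ := h2
  refine ⟨S.comp T, e * c, by positivity, fun x => ?_⟩
  calc e * c * ‖x‖ = e * (c * ‖x‖) := by ring
    _ ≤ e * ‖T x‖ := by have := hT x; gcongr
    _ ≤ _ := hS _

theorem embeds_of_iso {X Y : Type*} [NormedAddCommGroup X] [NormedSpace ℝ X]
    [NormedAddCommGroup Y] [NormedSpace ℝ Y] (h : IsomorphicTo X Y) : Embeds X Y := by
  obtain ⟨e⟩ := h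
  refine ⟨e.toContinuousLinearMap, (‖(e.symm : Y →L[ℝ] X)‖ + 1)⁻¹, by positivity, fun x => ?_⟩
  rw [inv_mul_le_iff₀ (by positivity)]
  have := (e.symm : Y →L[ℝ] X).le_opNorm (e x)
  simp only [ContinuousLinearEquiv.coe_coe, ContinuousLinearEquiv.symm_apply_apply] at this
  have h2 := norm_nonneg (e x)
  change ‖x‖ ≤ (‖(e.symm : Y →L[ℝ] X)‖ + 1) * ‖e x‖
  linarith

/-- linear combinations -/
abbrev lc {E : Type*} [AddCommGroup E] [Module ℝ E] (x : ℕ → E) : (ℕ →₀ ℝ) →ₗ[ℝ] E :=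
  Finsupp.linearCombination ℝ x

theorem embSpan {E V : Type*} [NormedAddCommGroup E] [NormedSpace ℝ E] [NormedAddCommGroup V]
    [NormedSpace ℝ V] [CompleteSpace V] (x : ℕ → E) (y : ℕ → V) {c C : ℝ} (hc : 0 < c)
    (h1 : ∀ a, c * ‖lc x a‖ ≤ ‖lc y a‖) (h2 : ∀ a, ‖lc y a‖ ≤ C * ‖lc x a‖) :
    Embeds (Submodule.span ℝ (Set.range x)).topologicalClosure V := by
  have hmem : ∀ a, lc x a ∈ (Submodule.span ℝ (Set.range x)).topologicalClosure := fun a =>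
    Submodule.le_topologicalClosure _ (by
      rw [← Finsupp.range_linearCombination]; exact ⟨a, rfl⟩)
  refine extEmb ((lc x).codRestrict _ hmem) ?_ (lc y) hc h1 h2
  intro y
  rw [closure_subtype]
  refine closure_mono ?_ y.2
  intro v hv
  rw [SetLike.mem_coe, ← Finsupp.range_linearCombination] at hv
  obtain ⟨a, rfl⟩ := hv
  exact ⟨_, ⟨a, rfl⟩, rfl⟩

/-! ### biorthogonal systems -/
section biorth
variable {Z : Type*} [NormedAddCommGroup Z] [NormedSpace ℝ Z]

theorem exists_psi (v : Z) : ∃ ψ : Z →L[ℝ] ℝ, v ≠ 0 → ψ v = 1 := by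
  by_cases h : v = 0
  · exact ⟨0, fun h' => absurd h h'⟩
  · obtain ⟨ψ, hψ⟩ := SeparatingDual.exists_eq_one (R := ℝ) h
    exact ⟨ψ, fun _ => hψ⟩

open Classical in
def phi (P : Z →L[ℝ] Z) (v : Z) : Z →L[ℝ] ℝ :=
  if v = 0 then 0 else (exists_psi v).choose.comp P

def PP (z : ℕ → Z) : ℕ → (Z →L[ℝ] Z)
  | 0 => ContinuousLinearMap.id ℝ Z
  | n+1 => PP z n - (phi (PP z n) (PP z n (z n))).smulRight (PP z n (z n))

variable (z : ℕ → Z)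

def xx (n : ℕ) : Z := PP z n (z n)
def ph (n : ℕ) : Z →L[ℝ] ℝ := phi (PP z n) (xx z n)

theorem PP_succ (n : ℕ) (v : Z) : PP z (n+1) v = PP z n v - ph z n v • xx z n := rfl

theorem ph_of_zero {n : ℕ} (h : xx z n = 0) : ph z n = 0 := by simp [ph, phi, h]

theorem ph_of_ne {n : ℕ} (h : xx z n ≠ 0) : ∃ ψ : Z →L[ℝ] ℝ, ψ (xx z n) = 1 ∧
    ∀ v, ph z n v = ψ (PP z n v) := by
  refine ⟨(exists_psi (xx z n)).choose, (exists_psi (xx z n)).choose_spec h, fun v => ?_⟩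
  simp [ph, phi, h]

theorem ph_of_PP {n : ℕ} {v : Z} (h : PP z n v = 0) : ph z n v = 0 := by
  by_cases hx : xx z n = 0
  · rw [ph_of_zero z hx]; rfl
  · obtain ⟨ψ, -, h2⟩ := ph_of_ne z hx
    rw [h2, h, map_zero]

theorem PP_idem (n : ℕ) (v : Z) : PP z n (PP z n v) = PP z n v := by
  induction n generalizing v with
  | zero => rfl
  | succ n ih =>
    by_cases hx : xx z n = 0
    · simp only [PP_succ, hx, smul_zero, sub_zero, ih]
    · obtain ⟨ψ, h1, h2⟩ := ph_of_ne z hx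
      have hxx : PP z n (xx z n) = xx z n := ih _
      simp only [PP_succ, map_sub, map_smul, ih, hxx, h2, h1, smul_eq_mul, mul_one]
      simp

theorem PP_xx (n : ℕ) : PP z n (xx z n) = xx z n := PP_idem z n _

theorem ph_xx {n : ℕ} (h : xx z n ≠ 0) : ph z n (xx z n) = 1 := by
  obtain ⟨ψ, h1, h2⟩ := ph_of_ne z h
  rw [h2, PP_xx, h1]

theorem ph_PP (n : ℕ) (v : Z) : ph z n (PP z n v) = ph z n v := by
  by_cases hx : xx z n = 0
  · rw [ph_of_zero z hx]; rfl
  · obtain ⟨ψ, -, h2⟩ := ph_of_ne z hx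
    rw [h2, h2, PP_idem]

theorem PP_xx_zero {n m : ℕ} (h : n < m) : PP z m (xx z n) = 0 := by
  induction m, h using Nat.le_induction with
  | base =>
    rw [PP_succ, PP_xx]
    by_cases hx : xx z n = 0
    · simp [hx]
    · rw [ph_xx z hx, one_smul, sub_self]
  | succ m _ ih => rw [PP_succ, ih, ph_of_PP z ih, zero_smul, sub_zero]

theorem ph_PP_zero {n m : ℕ} (h : n < m) (v : Z) : ph z n (PP z m v) = 0 := by
  induction m, h using Nat.le_induction generalizing v with
  | base =>
    by_cases hx : xx z n = 0
    · rw [ph_of_zero z hx]; rfl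
    · rw [PP_succ, map_sub, map_smul, ph_xx z hx, ph_PP, smul_eq_mul, mul_one, sub_self]
  | succ m _ ih =>
    have : ph z n (xx z m) = 0 := ih _
    rw [PP_succ, map_sub, map_smul, ih, this, smul_zero, sub_zero]

theorem ph_xx_zero {n m : ℕ} (h : m ≠ n) : ph z n (xx z m) = 0 := by
  rcases lt_or_gt_of_ne h with h | h
  · exact ph_of_PP z (PP_xx_zero z h)
  · exact ph_PP_zero z h _

theorem sub_PP_mem (n : ℕ) (v : Z) : v - PP z n v ∈ Submodule.span ℝ (Set.range (xx z)) := by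
  induction n with
  | zero => simp [PP]
  | succ n ih =>
    rw [PP_succ, ← sub_add]
    exact add_mem ih (Submodule.smul_mem _ _ (Submodule.subset_span ⟨n, rfl⟩))

theorem z_mem (n : ℕ) : z n ∈ Submodule.span ℝ (Set.range (xx z)) := by
  have := add_mem (sub_PP_mem z n (z n)) (Submodule.subset_span ⟨n, rfl⟩ :
    xx z n ∈ Submodule.span ℝ (Set.range (xx z)))
  rwa [xx, sub_add_cancel] at this

theorem ph_lc {n : ℕ} (h : xx z n ≠ 0) (a : ℕ →₀ ℝ) : ph z n (lc (xx z) a) = a n := by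
  classical
  rw [lc, Finsupp.linearCombination_apply, Finsupp.sum, map_sum,
    Finset.sum_eq_single n]
  · rw [map_smul, ph_xx z h, smul_eq_mul, mul_one]
  · intro m _ hm
    rw [map_smul, ph_xx_zero z hm, smul_zero]
  · intro hn
    rw [Finsupp.notMem_support_iff.1 hn, zero_smul, map_zero]

theorem geom_half (s : Finset ℕ) : ∑ n ∈ s, (1/2 : ℝ) ^ (n+2) ≤ 1/2 := by
  have h1 : HasSum (fun n : ℕ => (1/2 : ℝ) ^ (n+2)) (1/2) := by
    have := hasSum_geometric_two.mul_right ((1/2 : ℝ)^2)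
    have e : (fun n : ℕ => (1/2 : ℝ) ^ (n+2)) = fun n => (1/2 : ℝ)^n * (1/2)^2 := by
      funext n; rw [pow_add]
    have e2 : (2:ℝ) * (1/2)^2 = 1/2 := by norm_num
    rw [e2] at this
    rw [e]; exact this
  exact sum_le_hasSum s (fun _ _ => by positivity) h1

end biorth

def Eqv (x y : ℕ → CantorC) : Prop := ∀ a, ‖lc x a‖ ≤ 2 * ‖lc y a‖ ∧ ‖lc y a‖ ≤ 2 * ‖lc x a‖

theorem perturb {Z : Type*} [NormedAddCommGroup Z] [NormedSpace ℝ Z]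
    [TopologicalSpace.SeparableSpace Z] (J : Z →ₗᵢ[ℝ] CantorC) (d : ℕ → CantorC)
    (hd : DenseRange d) (hd0 : d 0 = 0) :
    ∃ (x : ℕ → Z) (y : ℕ → ℕ), Dense ((Submodule.span ℝ (Set.range x)) : Set Z) ∧
      Eqv (fun n => J (x n)) (fun n => d (y n)) := by
  let z := TopologicalSpace.denseSeq Z
  have hy : ∀ n, ∃ k, (xx z n = 0 → d k = 0) ∧
      ‖J (xx z n) - d k‖ * ‖ph z n‖ ≤ (1/2)^(n+2) := by
    intro n
    by_cases h : xx z n = 0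
    · exact ⟨0, fun _ => hd0, by simp [h, hd0]⟩
    · have hpos : (0:ℝ) < (1/2)^(n+2) / (‖ph z n‖ + 1) := by positivity
      obtain ⟨k, hk⟩ := hd.exists_dist_lt (J (xx z n)) hpos
      refine ⟨k, fun h' => absurd h' h, ?_⟩
      rw [dist_eq_norm, lt_div_iff₀ (by positivity)] at hk
      have := norm_nonneg (J (xx z n) - d k)
      nlinarith
  choose y hy0 hy using hy
  refine ⟨xx z, y, ?_, ?_⟩
  · refine (TopologicalSpace.denseRange_denseSeq Z).mono ?_
    rintro _ ⟨n, rfl⟩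
    exact z_mem z n
  · have key : ∀ a, ‖lc (fun n => J (xx z n)) a - lc (fun n => d (y n)) a‖ ≤
        1/2 * ‖lc (fun n => J (xx z n)) a‖ := by
      intro a
      have e1 : lc (fun n => J (xx z n)) a = J (lc (xx z) a) := by
        simp only [lc, Finsupp.linearCombination_apply, Finsupp.sum, map_sum, map_smul]
      rw [e1, J.norm_map, ← e1]
      simp only [lc, Finsupp.linearCombination_apply, Finsupp.sum]
      rw [← Finset.sum_sub_distrib]
      refine (norm_sum_le _ _).trans ?_
      have h1 : ∀ n ∈ a.support, ‖a n • J (xx z n) - a n • d (y n)‖ ≤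
          (1/2)^(n+2) * ‖lc (xx z) a‖ := by
        intro n _
        by_cases h : xx z n = 0
        · simp only [h, hy0 n h, map_zero, smul_zero, sub_zero, norm_zero]; positivity
        · rw [← smul_sub, norm_smul, ← ph_lc z h a]
          calc ‖ph z n (lc (xx z) a)‖ * ‖J (xx z n) - d (y n)‖
              ≤ (‖ph z n‖ * ‖lc (xx z) a‖) * ‖J (xx z n) - d (y n)‖ := by
                gcongr; exact (ph z n).le_opNorm _
            _ = (‖J (xx z n) - d (y n)‖ * ‖ph z n‖) * ‖lc (xx z) a‖ := by ring
            _ ≤ _ := by gcongr; exact hy n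
      refine (Finset.sum_le_sum h1).trans ?_
      rw [← Finset.sum_mul]
      exact mul_le_mul_of_nonneg_right (geom_half _) (norm_nonneg _)
    intro a
    have h := key a
    have h1 := norm_sub_norm_le (lc (fun n => J (xx z n)) a) (lc (fun n => d (y n)) a)
    have h2 := norm_sub_norm_le (lc (fun n => d (y n)) a) (lc (fun n => J (xx z n)) a)
    rw [norm_sub_rev] at h2
    have h3 := norm_nonneg (lc (fun n => J (xx z n)) a)
    constructor <;> linarith

theorem exists_d : ∃ d : ℕ → CantorC, (∀ n, d n ∈ LL) ∧ DenseRange d ∧ d 0 = 0 := by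
  haveI : Nonempty LL := ⟨0⟩
  let u := TopologicalSpace.denseSeq LL
  refine ⟨fun n => Nat.casesOn n 0 fun k => (u k : CantorC), ?_, ?_, rfl⟩
  · rintro (_ | k)
    · exact zero_mem _
    · exact (u k).2
  · have h1 : DenseRange fun k => (u k : CantorC) := by
      have h2 : DenseRange (Subtype.val : LL → CantorC) := by
        rw [denseRange_subtype_val]; exact dense_LL
      exact h2.comp (TopologicalSpace.denseRange_denseSeq LL) continuous_subtype_val
    refine h1.mono ?_
    rintro _ ⟨k, rfl⟩
    exact ⟨k+1, rfl⟩

end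
end BB

namespace BB
noncomputable section

section ana
local instance : MeasurableSpace CantorC := borel _
local instance : BorelSpace CantorC := ⟨rfl⟩

theorem meas_mem (f : (ℕ → ℕ) → SB) (hf : Measurable f) :
    MeasurableSet {p : (ℕ → ℕ) × CantorC | p.2 ∈ (f p.1).1} := by
  have hU : ∀ U : Set CantorC, IsOpen U →
      MeasurableSet {σ : ℕ → ℕ | (((f σ).1 : Set CantorC) ∩ U).Nonempty} := by
    intro U hU
    exact hf (MeasurableSpace.measurableSet_generateFrom ⟨U, hU, rfl⟩)
  have hb := TopologicalSpace.isBasis_countableBasis CantorC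
  have e : {p : (ℕ → ℕ) × CantorC | p.2 ∈ (f p.1).1} =
      ⋂ U ∈ TopologicalSpace.countableBasis CantorC,
        (Prod.fst ⁻¹' {σ : ℕ → ℕ | (((f σ).1 : Set CantorC) ∩ U).Nonempty} ∪ Prod.snd ⁻¹' Uᶜ) := by
    ext ⟨σ, c⟩
    simp only [Set.mem_ofPred_eq, Set.mem_iInter, Set.mem_union, Set.mem_preimage, Set.mem_compl_iff]
    constructor
    · intro h U _
      by_cases hc : c ∈ U
      · exact Or.inl ⟨c, h, hc⟩
      · exact Or.inr hc
    · intro h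
      have : c ∈ closure ((f σ).1 : Set CantorC) := by
        rw [hb.mem_closure_iff]
        intro U hUb hc
        rcases h U hUb with h | h
        · rwa [Set.inter_comm]
        · exact absurd hc h
      rwa [(f σ).2.closure_eq] at this
  rw [e]
  refine MeasurableSet.biInter (TopologicalSpace.countable_countableBasis _) fun U hUb => ?_
  exact (measurable_fst (hU U (hb.isOpen hUb))).union
    (measurable_snd (hb.isOpen hUb).measurableSet.compl)

theorem cont_lc (a : ℕ →₀ ℝ) : Continuous fun x : ℕ → CantorC => lc x a := by
  simp only [lc, Finsupp.linearCombination_apply, Finsupp.sum]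
  fun_prop

theorem closed_eqv : IsClosed {p : (ℕ → CantorC) × (ℕ → CantorC) | Eqv p.1 p.2} := by
  have : {p : (ℕ → CantorC) × (ℕ → CantorC) | Eqv p.1 p.2} =
    ⋂ a : ℕ →₀ ℝ, {p | ‖lc p.1 a‖ ≤ 2 * ‖lc p.2 a‖} ∩ {p | ‖lc p.2 a‖ ≤ 2 * ‖lc p.1 a‖} := by
    ext p; simp [Eqv]
  rw [this]
  refine isClosed_iInter fun a => ?_
  have h1 : Continuous fun p : (ℕ → CantorC) × (ℕ → CantorC) => ‖lc p.1 a‖ :=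
    ((cont_lc a).comp continuous_fst).norm
  have h2 : Continuous fun p : (ℕ → CantorC) × (ℕ → CantorC) => ‖lc p.2 a‖ :=
    ((cont_lc a).comp continuous_snd).norm
  exact (isClosed_le h1 (h2.const_mul 2)).inter (isClosed_le h2 (h1.const_mul 2))

theorem polW {E : Type*} [TopologicalSpace E] [PolishSpace E] :
    PolishSpace ((ℕ → ℕ) × (ℕ → E) × (ℕ → ℕ)) := inferInstance

theorem borW {E : Type*} [TopologicalSpace E] [PolishSpace E] [MeasurableSpace E] [BorelSpace E] :
    BorelSpace ((ℕ → ℕ) × (ℕ → E) × (ℕ → ℕ)) := inferInstance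

abbrev W : Type := (ℕ → ℕ) × (ℕ → CantorC) × (ℕ → ℕ)

theorem analytic_B (f : (ℕ → ℕ) → SB) (hf : Measurable f) (d : ℕ → CantorC) :
    AnalyticSet {y : ℕ → ℕ | ∃ (σ : ℕ → ℕ) (x : ℕ → CantorC), (∀ n, x n ∈ (f σ).1) ∧
      Eqv x (fun n => d (y n))} := by
  have : PolishSpace W := polW
  have : BorelSpace W := borW
  let M : Set W := {w | (∀ n, w.2.1 n ∈ (f w.1).1) ∧ Eqv w.2.1 (fun n => d (w.2.2 n))}
  have hM : MeasurableSet M := by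
    have h1 : MeasurableSet {w : W | ∀ n, w.2.1 n ∈ (f w.1).1} := by
      have : {w : W | ∀ n, w.2.1 n ∈ (f w.1).1} =
          ⋂ n, (fun w : W => (w.1, w.2.1 n)) ⁻¹' {p : (ℕ → ℕ) × CantorC | p.2 ∈ (f p.1).1} := by
        ext w; simp
      rw [this]
      refine MeasurableSet.iInter fun n => ?_
      have : Measurable (fun w : W => (w.1, w.2.1 n)) :=
        measurable_fst.prodMk ((measurable_pi_apply n).comp (measurable_fst.comp measurable_snd))
      exact this (meas_mem f hf)
    have h2 : MeasurableSet {w : W | Eqv w.2.1 (fun n => d (w.2.2 n))} := by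
      have hc : Continuous (fun w : W => (w.2.1, fun n => d (w.2.2 n))) := by
        refine (continuous_fst.comp continuous_snd).prodMk (continuous_pi fun n => ?_)
        exact continuous_of_discreteTopology.comp
          ((continuous_apply n).comp (continuous_snd.comp continuous_snd))
      exact (closed_eqv.preimage hc).measurableSet
    exact h1.inter h2
  have := hM.analyticSet.image_of_continuous
    (continuous_snd.comp continuous_snd : Continuous (fun w : W => w.2.2))
  convert this using 1
  ext y
  constructor
  · rintro ⟨σ, x, h⟩
    exact ⟨(σ, x, y), h, rfl⟩
  · rintro ⟨⟨σ, x, y'⟩, h, rfl⟩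
    exact ⟨σ, x, h⟩

end ana

/-- the tree data. -/
def TDD (d : ℕ → CantorC) (g : (ℕ → ℕ) → (ℕ → ℕ)) : TD (ℕ × ℕ) where
  K := {β | g (fun n => (β n).1) = fun n => (β n).2}
  X := fun β n => Submodule.span ℝ {v | (∃ k < n, v = d (β k).2) ∧ v ∈ SS n}
  hX := fun β n => Submodule.span_le.2 fun v hv => hv.2
  mono := fun β n m h => Submodule.span_mono fun v hv =>
    ⟨hv.1.imp fun k hk => ⟨hk.1.trans_le h, hk.2⟩, SS_mono h hv.2⟩
  loc := fun σ τ n h => by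
    congr 1
    ext v
    simp only [Set.mem_ofPred_eq]
    refine and_congr_left fun _ => exists_congr fun k => and_congr_right fun hk => ?_
    rw [h k hk]

theorem TDD_sup (d : ℕ → CantorC) (hd : ∀ n, d n ∈ LL) (g) (β : ℕ → ℕ × ℕ) :
    ⨆ n, (TDD d g).X β n = Submodule.span ℝ (Set.range fun n => d (β n).2) := by
  apply le_antisymm
  · refine iSup_le fun n => Submodule.span_le.2 ?_
    rintro v ⟨⟨k, -, rfl⟩, -⟩
    exact Submodule.subset_span ⟨k, rfl⟩
  · refine Submodule.span_le.2 ?_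
    rintro _ ⟨k, rfl⟩
    obtain ⟨m, hm⟩ := hd (β k).2
    refine Submodule.mem_iSup_of_mem (max m (k+1)) (Submodule.subset_span ?_)
    exact ⟨⟨k, by omega, rfl⟩, SS_mono (le_max_left _ _) hm⟩

theorem TDD_closed (d : ℕ → CantorC) (g) (hg : Continuous g) (σ : ℕ → ℕ × ℕ)
    (h : ∀ n, ∃ τ ∈ (TDD d g).K, ∀ l < n, τ l = σ l) : σ ∈ (TDD d g).K := by
  choose τ h1 h2 using h
  have ht : Tendsto τ atTop (𝓝 σ) := by
    rw [tendsto_pi_nhds]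
    intro l
    refine tendsto_const_nhds.congr' ?_
    filter_upwards [eventually_gt_atTop l] with n hn
    exact (h2 n l hn).symm
  have hc : IsClosed (TDD d g).K := by
    refine isClosed_eq (hg.comp ?_) ?_ <;> fun_prop
  exact hc.mem_of_tendsto ht (Eventually.of_forall h1)


def inclG {E : Type*} [NormedAddCommGroup E] [NormedSpace ℝ E] (Z : Submodule ℝ E) :
    Z →ₗᵢ[ℝ] E := Z.subtypeₗᵢ

theorem norm_lc_isom {Z E : Type*} [NormedAddCommGroup Z] [NormedSpace ℝ Z]
    [NormedAddCommGroup E] [NormedSpace ℝ E] (J : Z →ₗᵢ[ℝ] E) (x : ℕ → Z) (a : ℕ →₀ ℝ) :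
    ‖lc (fun n => J (x n)) a‖ = ‖lc x a‖ := by
  rw [← J.norm_map]
  congr 1
  simp [lc, Finsupp.linearCombination_apply, Finsupp.sum]

theorem embA {Z : Type*} [NormedAddCommGroup Z] [NormedSpace ℝ Z] [CompleteSpace Z]
    (J : Z →ₗᵢ[ℝ] CantorC) (y : ℕ → CantorC) (x : ℕ → Z) (hxy : Eqv (fun n => J (x n)) y) :
    Embeds (Submodule.span ℝ (Set.range y)).topologicalClosure Z := by
  refine embSpan y x (c := 1/2) (C := 2) (by norm_num) (fun a => ?_) (fun a => ?_)
  · rw [← norm_lc_isom J]; linarith [(hxy a).2]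
  · rw [← norm_lc_isom J]; exact (hxy a).1

theorem embB0 {Z S : Type*} [NormedAddCommGroup Z] [NormedSpace ℝ Z] [NormedAddCommGroup S]
    [NormedSpace ℝ S] [CompleteSpace S]
    (J : Z →ₗᵢ[ℝ] CantorC) (I : S →ₗᵢ[ℝ] CantorC) (x : ℕ → Z) (y : ℕ → S)
    (hd : Dense ((Submodule.span ℝ (Set.range x)) : Set Z))
    (hxy : Eqv (fun n => J (x n)) (fun n => I (y n))) : Embeds Z S := by
  refine extEmb (lc x) ?_ (lc y) (c := 1/2) (C := 2)
      (by norm_num) (fun a => ?_) (fun a => ?_)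
  · rw [← Finsupp.range_linearCombination] at hd
    exact hd
  · rw [← norm_lc_isom J, ← norm_lc_isom I]; linarith [(hxy a).1]
  · rw [← norm_lc_isom J, ← norm_lc_isom I]; exact (hxy a).2

theorem embB {Z : Type*} [NormedAddCommGroup Z] [NormedSpace ℝ Z]
    (J : Z →ₗᵢ[ℝ] CantorC) (x : ℕ → Z) (y : ℕ → CantorC)
    (hd : Dense ((Submodule.span ℝ (Set.range x)) : Set Z))
    (hxy : Eqv (fun n => J (x n)) y) :
    Embeds Z (Submodule.span ℝ (Set.range y)).topologicalClosure := by
  have : CompleteSpace (Submodule.span ℝ (Set.range y)).topologicalClosure :=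
    (Submodule.isClosed_topologicalClosure _).completeSpace_coe
  have hmem : ∀ n, y n ∈ (Submodule.span ℝ (Set.range y)).topologicalClosure := fun n =>
    Submodule.le_topologicalClosure _ (Submodule.subset_span ⟨n, rfl⟩)
  exact embB0 J (Submodule.subtypeₗᵢ _) x (fun n => ⟨y n, hmem n⟩) hd hxy

theorem nonunivD (d : ℕ → CantorC) (hdL : ∀ n, d n ∈ LL) (g) (hg : Continuous g)
    (h : ∀ y ∈ Set.range g, ¬ Embeds CantorC
      (Submodule.span ℝ (Set.range fun n => d (y n))).topologicalClosure) :
    ¬ Embeds CantorC (UniformSpace.Completion (VV (TDD d g))) := by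
  refine amalgam_nonuniv (D := TDD d g) (TDD_closed d g hg) fun β hβ => ?_
  rw [TDD_sup d hdL]
  exact h (fun n => (β n).2) ⟨_, hβ⟩

theorem branchD (d : ℕ → CantorC) (hdL : ∀ n, d n ∈ LL) (g) (y : ℕ → ℕ) (hy : y ∈ Set.range g) :
    Embeds (Submodule.span ℝ (Set.range fun n => d (y n))).topologicalClosure
      (UniformSpace.Completion (VV (TDD d g))) := by
  obtain ⟨u, hu⟩ := hy
  have hβ : (fun n => (u n, y n)) ∈ (TDD d g).K := hu
  have := embeds_branch (TDD d g) hβ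
  rwa [TDD_sup d hdL] at this

theorem hptL (Z : Submodule ℝ CantorC) (d : ℕ → CantorC)
    (hdd : DenseRange d) (hd0 : d 0 = 0) : ∃ (x : ℕ → Z) (y : ℕ → ℕ),
      Dense ((Submodule.span ℝ (Set.range x)) : Set Z) ∧
      Eqv (fun n => inclG Z (x n)) (fun n => d (y n)) :=
  perturb (inclG Z) d hdd hd0

theorem dirA (C : Set SB)
    (hB : ∀ (Y : Type) [NormedAddCommGroup Y] [NormedSpace ℝ Y] [CompleteSpace Y]
        [TopologicalSpace.SeparableSpace Y],
        (∀ X ∈ C, Embeds ↥X.1 Y) → Embeds CantorC Y)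
    (A : Set SB) (hA : IsAnalyticIn A)
    (hCA : ∀ X ∈ C, ∃ Z ∈ A, IsomorphicTo ↥X.1 ↥Z.1) :
    ∃ Y ∈ A, Embeds CantorC ↥Y.1 := by
  by_contra hno
  push Not at hno
  obtain ⟨f, hf, rfl⟩ := hA
  obtain ⟨d, hdL, hdd, hd0⟩ := exists_d
  have hpt := fun σ => hptL (f σ).1 d hdd hd0
  have han := analytic_B f hf d
  rw [AnalyticSet] at han
  rcases han with he | ⟨g, hg, hgr⟩
  · obtain ⟨x, y, -, hxy⟩ := hpt 0
    have : y ∈ (∅ : Set (ℕ → ℕ)) := by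
      rw [← he]; exact ⟨0, fun n => (x n : CantorC), fun n => (x n).2, hxy⟩
    exact this
  refine nonunivD d hdL g hg (fun y hy hE => ?_) (hB _ fun X hX => ?_)
  · rw [hgr] at hy
    obtain ⟨σ, x, hx, hxy⟩ := hy
    have : CompleteSpace ↥(f σ).1 := (f σ).2.completeSpace_coe
    exact hno (f σ) ⟨σ, rfl⟩ (embeds_trans hE
      (embA (inclG (f σ).1) _ (fun n => ⟨x n, hx n⟩) hxy))
  obtain ⟨_, ⟨σ, rfl⟩, hiso⟩ := hCA X hX
  refine embeds_trans (embeds_of_iso hiso) ?_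
  obtain ⟨x, y, hd, hxy⟩ := hpt σ
  have hy : y ∈ Set.range g := by
    rw [hgr]; exact ⟨σ, fun n => (x n : CantorC), fun n => (x n).2, hxy⟩
  exact embeds_trans (embB (inclG (f σ).1) x _ hd hxy) (branchD d hdL g y hy)

end
end BB

namespace BB
noncomputable section

theorem banach_mazur (Y : Type*) [NormedAddCommGroup Y] [NormedSpace ℝ Y]
    [TopologicalSpace.SeparableSpace Y] : Nonempty (Y →ₗᵢ[ℝ] CantorC) := by
  let K : Set (WeakDual ℝ Y) := WeakDual.toStrongDual ⁻¹' Metric.closedBall 0 1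
  have hK : IsCompact K := WeakDual.isCompact_closedBall 0 1
  have : CompactSpace K := isCompact_iff_compactSpace.1 hK
  have : TopologicalSpace.MetrizableSpace K := WeakDual.metrizable_of_isCompact ℝ Y K hK
  let := TopologicalSpace.metrizableSpaceMetric K
  have : Nonempty K := ⟨⟨0, by simp [K]⟩⟩
  obtain ⟨f, hf, hs⟩ := exists_nat_bool_continuous_surjective_of_compact K
  have hcont : ∀ y : Y, Continuous fun t => (f t).1 y := fun y =>
    (WeakDual.eval_continuous y).comp (continuous_subtype_val.comp hf)
  let L : Y →ₗ[ℝ] CantorC :=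
    { toFun := fun y => ⟨fun t => (f t).1 y, hcont y⟩
      map_add' := fun a b => by ext t; exact map_add (f t).1 a b
      map_smul' := fun r a => by ext t; exact map_smul (f t).1 r a }
  refine ⟨⟨L, fun y => ?_⟩⟩
  apply le_antisymm
  · rw [ContinuousMap.norm_le _ (norm_nonneg _)]
    intro t
    have h1 : ‖WeakDual.toStrongDual (f t).1‖ ≤ 1 := by
      have h0 : WeakDual.toStrongDual (f t).1 ∈ Metric.closedBall 0 1 := (f t).2
      exact mem_closedBall_zero_iff.1 h0
    have h2 := (WeakDual.toStrongDual (f t).1).le_opNorm y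
    calc ‖L y t‖ = ‖(WeakDual.toStrongDual (f t).1) y‖ := rfl
      _ ≤ _ := h2
      _ ≤ 1 * ‖y‖ := by gcongr
      _ = _ := one_mul _
  · obtain ⟨φ, hφ, hy⟩ := exists_dual_vector'' ℝ y
    obtain ⟨t, ht⟩ := hs ⟨StrongDual.toWeakDual φ, by simpa [K] using hφ⟩
    have h3 : L y t = ‖y‖ := by
      change (f t).1 y = _
      rw [ht]
      exact hy
    calc ‖y‖ = L y t := h3.symm
      _ ≤ ‖L y t‖ := le_abs_self _
      _ ≤ ‖L y‖ := ContinuousMap.norm_coe_le_norm _ t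

theorem isoRange {X E : Type*} [NormedAddCommGroup X] [NormedSpace ℝ X] [CompleteSpace X]
    [NormedAddCommGroup E] [NormedSpace ℝ E] [CompleteSpace E] (S : X →L[ℝ] E) {c : ℝ}
    (hc : 0 < c) (h : ∀ x, c * ‖x‖ ≤ ‖S x‖) (x : ℕ → X) (hx : DenseRange x) :
    IsomorphicTo X (Submodule.span ℝ (Set.range fun n => S (x n))).topologicalClosure := by
  have ha : AntilipschitzWith (Real.toNNReal c⁻¹) S := by
    refine ContinuousLinearMap.antilipschitz_of_bound S fun v => ?_
    rw [Real.coe_toNNReal _ (by positivity), inv_mul_eq_div, le_div_iff₀ hc, mul_comm]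
    exact h v
  have hcl : IsClosed (Set.range S) := ha.isClosed_range S.uniformContinuous
  have e : (Submodule.span ℝ (Set.range fun n => S (x n))).topologicalClosure =
      LinearMap.range S.toLinearMap := by
    apply le_antisymm
    · refine Submodule.topologicalClosure_minimal _ (Submodule.span_le.2 ?_) hcl
      rintro _ ⟨n, rfl⟩
      exact ⟨x n, rfl⟩
    · rintro _ ⟨v, rfl⟩
      have h1 : S v ∈ closure (S '' Set.range x) :=
        image_closure_subset_closure_image S.continuous ⟨v, hx v, rfl⟩
      refine closure_mono ?_ h1
      rintro _ ⟨_, ⟨n, rfl⟩, rfl⟩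
      exact Submodule.subset_span ⟨n, rfl⟩
  rw [e]
  exact ⟨S.equivRange ha.injective hcl⟩

/-- closed span map. -/
def cspan {Y : Type*} [NormedAddCommGroup Y] [NormedSpace ℝ Y] (J : Y →ₗᵢ[ℝ] CantorC)
    (u : ℕ → Y) : SB :=
  ⟨(Submodule.span ℝ (Set.range fun n => J (u n))).topologicalClosure,
    Submodule.isClosed_topologicalClosure _⟩

theorem cspan_meas {Y : Type*} [NormedAddCommGroup Y] [NormedSpace ℝ Y] (J : Y →ₗᵢ[ℝ] CantorC)
    (g : (ℕ → ℕ) → (ℕ → Y)) (hg : Continuous g) : Measurable fun σ => cspan J (g σ) := by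
  refine measurable_generateFrom ?_
  rintro _ ⟨U, hU, rfl⟩
  have e : (fun σ => cspan J (g σ)) ⁻¹' {Z : SB | ((Z.1 : Set CantorC) ∩ U).Nonempty} =
      ⋃ a : ℕ →₀ ℝ, (fun σ => lc (fun n => J (g σ n)) a) ⁻¹' U := by
    ext σ
    simp only [Set.mem_preimage, Set.mem_ofPred_eq, Set.mem_iUnion]
    change (closure ((Submodule.span ℝ (Set.range fun n => J (g σ n)) : Submodule ℝ CantorC) :
      Set CantorC) ∩ U).Nonempty ↔ _
    rw [closure_inter_open_nonempty_iff hU, ← Finsupp.range_linearCombination]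
    constructor
    · rintro ⟨_, ⟨a, rfl⟩, ha⟩
      exact ⟨a, ha⟩
    · rintro ⟨a, ha⟩
      exact ⟨_, ⟨a, rfl⟩, ha⟩
  rw [e]
  refine (isOpen_iUnion fun a => hU.preimage ?_).measurableSet
  refine (cont_lc a).comp (continuous_pi fun n => J.continuous.comp ?_)
  exact (continuous_apply n).comp hg

theorem polY {E : Type*} [TopologicalSpace E] [PolishSpace E] :
    PolishSpace (ℕ → E) := inferInstance

theorem dirB (C : Set SB)
    (hB : ∀ A : Set SB, IsAnalyticIn A →
        (∀ X ∈ C, ∃ Z ∈ A, IsomorphicTo ↥X.1 ↥Z.1) →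
        ∃ Y ∈ A, Embeds CantorC ↥Y.1)
    (Y : Type) [NormedAddCommGroup Y] [NormedSpace ℝ Y] [CompleteSpace Y]
    [TopologicalSpace.SeparableSpace Y]
    (hCY : ∀ X ∈ C, Embeds ↥X.1 Y) : Embeds CantorC Y := by
  obtain ⟨J⟩ := banach_mazur Y
  have : PolishSpace Y := inferInstance
  have : PolishSpace (ℕ → Y) := polY
  obtain ⟨g, hg, hs⟩ := PolishSpace.exists_nat_nat_continuous_surjective (ℕ → Y)
  obtain ⟨_, ⟨σ, rfl⟩, hE⟩ := hB (Set.range fun σ => cspan J (g σ)) ⟨_, cspan_meas J g hg, rfl⟩ (by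
    intro X hX
    obtain ⟨T, c, hc, hT⟩ := hCY X hX
    have : CompleteSpace ↥X.1 := X.2.completeSpace_coe
    have : TopologicalSpace.SeparableSpace ↥X.1 := inferInstance
    obtain ⟨σ, hσ⟩ := hs fun n => T (TopologicalSpace.denseSeq X.1 n)
    refine ⟨_, ⟨σ, rfl⟩, ?_⟩
    have := isoRange (J.toContinuousLinearMap.comp T) hc
      (fun x => by
        have := hT x
        rw [← J.norm_map] at this
        exact this)
      (TopologicalSpace.denseSeq X.1) (TopologicalSpace.denseRange_denseSeq X.1)
    have e : cspan J (g σ) = cspan J fun n => T (TopologicalSpace.denseSeq X.1 n) :=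
      congrArg (cspan J) hσ
    change IsomorphicTo X.1 (cspan J (g σ)).1
    rw [e]
    exact this)
  refine embeds_trans hE ?_
  refine embSpan (fun n => J (g σ n)) (g σ) (c := 1) (C := 1) one_pos (fun a => ?_) (fun a => ?_)
  · rw [one_mul, norm_lc_isom J]
  · rw [one_mul, norm_lc_isom J]

end
end BB

/-- **Corollary.** Bourgain genericity coincides with Bossard genericity, for every
isomorphic-invariant class `C` of non-universal separable Banach spaces. -/
theorem bourgain_generic_iff_bossard_generic (C : Set SB) (hCnu : C ⊆ NU)
    (hinv : ∀ X Y : SB, IsomorphicTo ↥X.1 ↥Y.1 → X ∈ C → Y ∈ C) :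
    (∀ (Y : Type) [NormedAddCommGroup Y] [NormedSpace ℝ Y] [CompleteSpace Y]
        [TopologicalSpace.SeparableSpace Y],
        (∀ X ∈ C, Embeds ↥X.1 Y) → Embeds CantorC Y) ↔
      (∀ A : Set SB, IsAnalyticIn A →
        (∀ X ∈ C, ∃ Z ∈ A, IsomorphicTo ↥X.1 ↥Z.1) →
        ∃ Y ∈ A, Embeds CantorC ↥Y.1) := by
  exact ⟨fun h A hA hCA => BB.dirA C h A hA hCA, fun h Y _ _ _ _ hY => BB.dirB C h Y hY⟩
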